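/- arXiv:1103.5361 — 4 statements merged into one kernel-verified Lean document; each statement's English description precedes it below -/
import Mathlib

section
/- Let Λ be an artin algebra and e an idempotent of Λ. Given a commutative diagram of finitely generated Λ-modules with exact rows 0 → L → M → N → 0 and vertical endomorphisms φ_L, φ_M, φ_N compatible with the maps, if L and N have e-bounded projective resolutions, then so does M, and tr_e(φ_M) = tr_e(φ_L) + tr_e(φ_N). -/
/-- The commutator subgroup [R,R]: additive subgroup generated by ab - ba. -/
def commSub (R : Type*) [Ring R] : AddSubgroup R :=
  AddSubgroup.closure {x | ∃ a b : R, x = a * b - b * a}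

/-- The zeroth Hochschild homology HH₀(R) = R/[R,R]. -/
abbrev HH0 (R : Type*) [Ring R] := R ⧸ commSub R

/-- Class of an element of R in HH₀(R). -/
def HH0.mk {R : Type*} [Ring R] (a : R) : HH0 R := QuotientAddGroup.mk a

/-- The group homomorphism HH₀(R) → HH₀(S) induced by a ring homomorphism. -/
def HH0.map {R S : Type*} [Ring R] [Ring S] (f : R →+* S) : HH0 R →+ HH0 S :=
  QuotientAddGroup.map _ _ f.toAddMonoidHom (by
    refine (AddSubgroup.closure_le _).mpr ?_
    rintro x ⟨a, b, rfl⟩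
    simp only [AddSubgroup.coe_comap, Set.mem_preimage, RingHom.toAddMonoidHom_eq_coe,
      AddMonoidHom.coe_coe, map_sub, map_mul, SetLike.mem_coe]
    exact AddSubgroup.subset_closure ⟨f a, f b, rfl⟩)

/-- The quotient ring Λ_e = Λ/Λ(1-e)Λ. -/
abbrev corner (Λ : Type*) [Ring Λ] (e : Λ) :=
  (TwoSidedIdeal.span {1 - e}).ringCon.Quotient

/-- The canonical projection Λ → Λ_e. -/
abbrev cornerProj (Λ : Type*) [Ring Λ] (e : Λ) : Λ →+* corner Λ e :=
  (TwoSidedIdeal.span {1 - e}).ringCon.mk'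

/-- The Jacobson radical of Λ, via the classical characterization:
x ∈ J(Λ) iff 1 - yx is invertible for every y. -/
def Jset (Λ : Type*) [Ring Λ] : Set Λ := {x | ∀ y : Λ, IsUnit (1 - y * x)}

/-- The right Λ-module e₁Λ ⊕ ⋯ ⊕ e_rΛ, realized as a Λᵐᵒᵖ-submodule of Λʳ. -/
def stdProj {Λ : Type*} [Ring Λ] {r : ℕ} (e : Fin r → Λ) : Submodule Λᵐᵒᵖ (Fin r → Λ) where
  carrier := {x | ∀ j, e j * x j = x j}
  add_mem' := by
    intro x y hx hy j
    simp only [Pi.add_apply, mul_add, hx j, hy j]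
  zero_mem' := by intro j; simp
  smul_mem' := by
    intro c x hx j
    simp only [Pi.smul_apply, MulOpposite.smul_eq_mul_unop, ← mul_assoc, hx j]

/-- The canonical generator of the j-th summand e_jΛ of e₁Λ ⊕ ⋯ ⊕ e_rΛ. -/
def stdBasis {Λ : Type*} [Ring Λ] {r : ℕ} (e : Fin r → Λ)
    (he : ∀ j, IsIdempotentElem (e j)) (j : Fin r) : stdProj e :=
  ⟨fun i => if i = j then e j else 0, by
    intro i
    by_cases h : i = j
    · subst h; simp; exact he i
    · simp [h]⟩

/-- The Hattori–Stallings trace of an endomorphism of P = e₁Λ ⊕ ⋯ ⊕ e_rΛ :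
the class in HH₀(Λ) of the sum of the diagonal entries of its representing matrix. -/
def trP {Λ : Type*} [Ring Λ] {r : ℕ} {e : Fin r → Λ} (he : ∀ j, IsIdempotentElem (e j))
    (φ : stdProj e →ₗ[Λᵐᵒᵖ] stdProj e) : HH0 Λ :=
  HH0.mk (∑ j, (φ (stdBasis e he j) : Fin r → Λ) j)

/-- A projective resolution of a right Λ-module M by finite direct sums of modules
of the form eΛ with e idempotent. -/
structure StdRes (Λ : Type*) [Ring Λ] (M : Type*) [AddCommGroup M] [Module Λᵐᵒᵖ M] where
  n : ℕ → ℕ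
  E : (i : ℕ) → Fin (n i) → Λ
  idem : ∀ i j, IsIdempotentElem (E i j)
  d : (i : ℕ) → (stdProj (E (i+1)) →ₗ[Λᵐᵒᵖ] stdProj (E i))
  aug : stdProj (E 0) →ₗ[Λᵐᵒᵖ] M
  surj : Function.Surjective aug
  exact0 : LinearMap.ker aug = LinearMap.range (d 0)
  exact : ∀ i, LinearMap.ker (d i) = LinearMap.range (d (i+1))

/-- A projective resolution is e-bounded if e annihilates the tops of all but finitely
many of its terms, i.e. for all large i the top of each summand E i j · Λ is killed by
right multiplication by e (equivalently E i j · Λ · e ⊆ E i j · J). -/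
def StdRes.EBounded {Λ : Type*} [Ring Λ] {M : Type*} [AddCommGroup M] [Module Λᵐᵒᵖ M]
    (e : Λ) (R : StdRes Λ M) : Prop :=
  ∃ N : ℕ, ∀ i ≥ N, ∀ j, ∀ x : Λ, R.E i j * x * e ∈ Jset Λ

/-- A lifting {φᵢ} of an endomorphism φ of M to a projective resolution of M. -/
def StdRes.IsLifting {Λ : Type*} [Ring Λ] {M : Type*} [AddCommGroup M] [Module Λᵐᵒᵖ M]
    (R : StdRes Λ M) (φ : M →ₗ[Λᵐᵒᵖ] M)
    (L : (i : ℕ) → (stdProj (R.E i) →ₗ[Λᵐᵒᵖ] stdProj (R.E i))) : Prop :=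
  (∀ x, R.aug (L 0 x) = φ (R.aug x)) ∧
  ∀ i, ∀ x, R.d i (L (i+1) x) = L i (R.d i x)

/-- The alternating sum Σᵢ (-1)ⁱ tr_e(φᵢ) ∈ HH₀(Λ_e) attached to a lifting {φᵢ}. -/
noncomputable def eTraceSum {Λ : Type*} [Ring Λ] {M : Type*} [AddCommGroup M]
    [Module Λᵐᵒᵖ M] (e : Λ) (R : StdRes Λ M)
    (L : (i : ℕ) → (stdProj (R.E i) →ₗ[Λᵐᵒᵖ] stdProj (R.E i))) : HH0 (corner Λ e) :=
  ∑ᶠ i : ℕ, ((-1 : ℤ)^i) • HH0.map (cornerProj Λ e) (trP (R.idem i) (L i))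


section helpers

lemma stdProj_mem {Λ : Type*} [Ring Λ] {r : ℕ} {e : Fin r → Λ} (x : stdProj e) (j : Fin r) :
    e j * (x : Fin r → Λ) j = (x : Fin r → Λ) j := x.2 j

/-- Retraction of Λʳ onto the standard projective. -/
def stdRetr {Λ : Type*} [Ring Λ] {r : ℕ} (e : Fin r → Λ) (he : ∀ j, IsIdempotentElem (e j)) :
    (Fin r → Λ) →ₗ[Λᵐᵒᵖ] stdProj e where
  toFun x := ⟨fun j => e j * x j, fun j => by
    have := he j
    simp only [← mul_assoc, this.eq]⟩
  map_add' x y := by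
    ext j; simp [mul_add]
  map_smul' c x := by
    ext j; simp [mul_assoc]

lemma free_op (Λ : Type*) [Ring Λ] : Module.Free Λᵐᵒᵖ Λ :=
  Module.Free.of_equiv
    ({ toFun := MulOpposite.unop
       invFun := MulOpposite.op
       map_add' := fun _ _ => rfl
       map_smul' := fun _ _ => rfl
       left_inv := fun _ => rfl
       right_inv := fun _ => rfl } : Λᵐᵒᵖ ≃ₗ[Λᵐᵒᵖ] Λ)

lemma stdProj_projective {Λ : Type*} [Ring Λ] {r : ℕ} (e : Fin r → Λ)
    (he : ∀ j, IsIdempotentElem (e j)) : Module.Projective Λᵐᵒᵖ (stdProj e) := by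
  have := free_op Λ
  refine Module.Projective.of_split (stdProj e).subtype (stdRetr e he) ?_
  ext x j
  exact stdProj_mem x j

/-- lifting through a map hitting all values -/
lemma lift_range {A P B C : Type*} [Ring A] [AddCommGroup P] [Module A P] [AddCommGroup B]
    [Module A B] [AddCommGroup C] [Module A C] [Module.Projective A P]
    (g : B →ₗ[A] C) (f : P →ₗ[A] C) (h : ∀ x, ∃ y, g y = f x) :
    ∃ l : P →ₗ[A] B, ∀ x, g (l x) = f x := by
  obtain ⟨l, hl⟩ := Module.projective_lifting_property g.rangeRestrict
    (f.codRestrict (LinearMap.range g) (fun x => h x)) g.surjective_rangeRestrict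
  refine ⟨l, fun x => ?_⟩
  exact congrArg Subtype.val (LinearMap.congr_fun hl x)

lemma dep_choice {X : ℕ → Type*} (p : ∀ i, X i → Prop) (r : ∀ i, X i → X (i+1) → Prop)
    (x0 : X 0) (h0 : p 0 x0) (hs : ∀ i x, p i x → ∃ y, r i x y ∧ p (i+1) y) :
    ∃ f : ∀ i, X i, f 0 = x0 ∧ ∀ i, r i (f i) (f (i+1)) := by
  choose g hg using hs
  let F : ∀ i, {x : X i // p i x} := fun i =>
    Nat.rec (motive := fun i => {x : X i // p i x}) ⟨x0, h0⟩
      (fun i x => ⟨g i x.1 x.2, (hg i x.1 x.2).2⟩) i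
  exact ⟨fun i => (F i).1, rfl, fun i => (hg i (F i).1 (F i).2).1⟩

/-- Master construction of twisted chain maps into an exact sequence. -/
lemma master {A : Type*} [Ring A] (P Q : ℕ → Type*)
    [∀ i, AddCommGroup (P i)] [∀ i, Module A (P i)]
    [∀ i, AddCommGroup (Q i)] [∀ i, Module A (Q i)] [∀ i, Module.Projective A (P i)]
    (δ : ∀ i, P (i+1) →ₗ[A] P i) (d : ∀ i, Q (i+1) →ₗ[A] Q i)
    (c : ∀ i, P (i+1) →ₗ[A] Q i)
    (hδ : ∀ i x, δ i (δ (i+1) x) = 0)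
    (hd : ∀ i, LinearMap.ker (d i) = LinearMap.range (d (i+1)))
    (hc : ∀ i x, d i (c (i+1) x) + c i (δ (i+1) x) = 0)
    (b0 : P 0 →ₗ[A] Q 0) (hb0 : ∀ x, ∃ y, d 0 y = b0 (δ 0 x) + c 0 x) :
    ∃ b : ∀ i, P i →ₗ[A] Q i, b 0 = b0 ∧
      ∀ i x, d i (b (i+1) x) = b i (δ i x) + c i x := by
  refine dep_choice (X := fun i => P i →ₗ[A] Q i)
    (fun i b => ∀ x, ∃ y, d i y = b (δ i x) + c i x)
    (fun i b b' => ∀ x, d i (b' x) = b (δ i x) + c i x) b0 hb0 ?_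
  intro i b hb
  obtain ⟨l, hl⟩ := lift_range (d i) (b ∘ₗ δ i + c i) hb
  refine ⟨l, hl, fun x => ?_⟩
  have : l (δ (i+1) x) + c (i+1) x ∈ LinearMap.ker (d i) := by
    rw [LinearMap.mem_ker, map_add, hl]
    simp only [LinearMap.add_apply, LinearMap.comp_apply, hδ, map_zero, zero_add]
    rw [add_comm]; exact hc i x
  rw [hd] at this
  exact this

/-! ### Traces -/

lemma HH0.mk_add {R : Type*} [Ring R] (a b : R) : HH0.mk (a + b) = HH0.mk a + HH0.mk b := rfl

lemma HH0.mk_comm {R : Type*} [Ring R] (a b : R) : HH0.mk (a * b) = HH0.mk (b * a) := by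
  refine (QuotientAddGroup.eq_iff_sub_mem).mpr ?_
  exact AddSubgroup.subset_closure ⟨a, b, rfl⟩

lemma HH0.mk_sum {R : Type*} [Ring R] {ι : Type*} (s : Finset ι) (f : ι → R) :
    HH0.mk (∑ i ∈ s, f i) = ∑ i ∈ s, HH0.mk (f i) :=
  map_sum (QuotientAddGroup.mk' (commSub R)) f s

lemma trP_add {Λ : Type*} [Ring Λ] {r : ℕ} {e : Fin r → Λ} (he : ∀ j, IsIdempotentElem (e j))
    (φ ψ : stdProj e →ₗ[Λᵐᵒᵖ] stdProj e) : trP he (φ + ψ) = trP he φ + trP he ψ := by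
  unfold trP
  rw [← HH0.mk_add, ← Finset.sum_add_distrib]
  rfl

lemma trP_zero {Λ : Type*} [Ring Λ] {r : ℕ} {e : Fin r → Λ} (he : ∀ j, IsIdempotentElem (e j)) :
    trP he (0 : stdProj e →ₗ[Λᵐᵒᵖ] stdProj e) = 0 := by
  have := trP_add he 0 0
  simpa using this

lemma std_expand {Λ : Type*} [Ring Λ] {r : ℕ} {e : Fin r → Λ} (he : ∀ j, IsIdempotentElem (e j))
    (x : stdProj e) :
    x = ∑ k, MulOpposite.op ((x : Fin r → Λ) k) • stdBasis e he k := by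
  ext j
  rw [AddSubmonoidClass.coe_finsetSum, Finset.sum_apply]
  simp [stdBasis, stdProj_mem x j]

lemma std_apply {Λ : Type*} [Ring Λ] {r s : ℕ} {e : Fin r → Λ} (he : ∀ j, IsIdempotentElem (e j))
    {f : Fin s → Λ} (g : stdProj e →ₗ[Λᵐᵒᵖ] stdProj f) (x : stdProj e) (j : Fin s) :
    (g x : Fin s → Λ) j = ∑ k, (g (stdBasis e he k) : Fin s → Λ) j * (x : Fin r → Λ) k := by
  conv_lhs => rw [std_expand he x]
  rw [map_sum, AddSubmonoidClass.coe_finsetSum, Finset.sum_apply]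
  simp

lemma trP_comm {Λ : Type*} [Ring Λ] {r s : ℕ} {e : Fin r → Λ} (he : ∀ j, IsIdempotentElem (e j))
    {f : Fin s → Λ} (hf : ∀ j, IsIdempotentElem (f j))
    (g : stdProj e →ₗ[Λᵐᵒᵖ] stdProj f) (h : stdProj f →ₗ[Λᵐᵒᵖ] stdProj e) :
    trP he (h ∘ₗ g) = trP hf (g ∘ₗ h) := by
  unfold trP
  simp only [LinearMap.comp_apply]
  simp_rw [fun j => std_apply hf h (g (stdBasis e he j)) j,
    fun j => std_apply he g (h (stdBasis f hf j)) j, HH0.mk_sum]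
  rw [Finset.sum_comm]
  refine Finset.sum_congr rfl fun k _ => Finset.sum_congr rfl fun j _ => ?_
  exact HH0.mk_comm _ _

/-- the e-trace on projectives -/
def etr {Λ : Type*} [Ring Λ] (e : Λ) {r : ℕ} {E : Fin r → Λ} (hE : ∀ j, IsIdempotentElem (E j))
    (φ : stdProj E →ₗ[Λᵐᵒᵖ] stdProj E) : HH0 (corner Λ e) :=
  HH0.map (cornerProj Λ e) (trP hE φ)

lemma etr_add {Λ : Type*} [Ring Λ] (e : Λ) {r : ℕ} {E : Fin r → Λ}
    (hE : ∀ j, IsIdempotentElem (E j)) (φ ψ : stdProj E →ₗ[Λᵐᵒᵖ] stdProj E) :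
    etr e hE (φ + ψ) = etr e hE φ + etr e hE ψ := by
  simp only [etr, trP_add, map_add]

lemma etr_comm {Λ : Type*} [Ring Λ] (e0 : Λ) {r s : ℕ} {e : Fin r → Λ}
    (he : ∀ j, IsIdempotentElem (e j))
    {f : Fin s → Λ} (hf : ∀ j, IsIdempotentElem (f j))
    (g : stdProj e →ₗ[Λᵐᵒᵖ] stdProj f) (h : stdProj f →ₗ[Λᵐᵒᵖ] stdProj e) :
    etr e0 he (h ∘ₗ g) = etr e0 hf (g ∘ₗ h) := by
  simp only [etr, trP_comm he hf]

lemma cornerProj_e {Λ : Type*} [Ring Λ] (e : Λ) : cornerProj Λ e e = 1 := by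
  rw [← map_one (cornerProj Λ e)]
  symm
  refine (RingCon.eq _).mpr ?_
  rw [TwoSidedIdeal.rel_iff]
  exact TwoSidedIdeal.subset_span rfl

lemma cornerProj_zero {Λ : Type*} [Ring Λ] (e f : Λ) (hf : IsIdempotentElem f)
    (h : f * e ∈ Jset Λ) : cornerProj Λ e f = 0 := by
  have hu := (h 1).map (cornerProj Λ e)
  rw [one_mul, map_sub, map_one, map_mul, cornerProj_e, mul_one] at hu
  have hi : IsIdempotentElem (cornerProj Λ e f) := hf.map _
  have h0 : (1 - cornerProj Λ e f) * cornerProj Λ e f = 0 := by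
    rw [sub_mul, hi.eq, one_mul, sub_self]
  exact (hu.mul_right_eq_zero).mp h0

lemma etr_zero {Λ : Type*} [Ring Λ] (e : Λ) {r : ℕ} {E : Fin r → Λ}
    (hE : ∀ j, IsIdempotentElem (E j)) (h : ∀ j, ∀ x : Λ, E j * x * e ∈ Jset Λ)
    (φ : stdProj E →ₗ[Λᵐᵒᵖ] stdProj E) : etr e hE φ = 0 := by
  have key : cornerProj Λ e (∑ j, (φ (stdBasis E hE j) : Fin r → Λ) j) = 0 := by
    rw [map_sum]
    refine Finset.sum_eq_zero fun j _ => ?_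
    rw [← stdProj_mem, map_mul, cornerProj_zero e (E j) (hE j) (by simpa using h j 1), zero_mul]
  change HH0.mk (cornerProj Λ e (∑ j, (φ (stdBasis E hE j) : Fin r → Λ) j)) = 0
  rw [key]; rfl

lemma eTraceSum_eq {Λ : Type*} [Ring Λ] {M : Type*} [AddCommGroup M]
    [Module Λᵐᵒᵖ M] (e : Λ) (R : StdRes Λ M)
    (L : (i : ℕ) → (stdProj (R.E i) →ₗ[Λᵐᵒᵖ] stdProj (R.E i))) (n : ℕ)
    (hn : ∀ i ≥ n, ∀ j, ∀ x : Λ, R.E i j * x * e ∈ Jset Λ) :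
    eTraceSum e R L = ∑ i ∈ Finset.range n, ((-1 : ℤ)^i) • etr e (R.idem i) (L i) := by
  refine finsum_eq_sum_of_support_subset _ ?_
  intro i hi
  rw [Finset.coe_range, Set.mem_Iio]
  by_contra hlt
  refine hi ?_
  change ((-1 : ℤ)^i) • etr e (R.idem i) (L i) = 0
  rw [etr_zero e _ (hn i (not_lt.mp hlt)), smul_zero]

lemma dd {Λ : Type*} [Ring Λ] {M : Type*} [AddCommGroup M]
    [Module Λᵐᵒᵖ M] (R : StdRes Λ M) (i : ℕ) (x) : R.d i (R.d (i+1) x) = 0 := by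
  have : R.d (i+1) x ∈ LinearMap.ker (R.d i) := by rw [R.exact]; exact ⟨x, rfl⟩
  exact this

lemma augd {Λ : Type*} [Ring Λ] {M : Type*} [AddCommGroup M]
    [Module Λᵐᵒᵖ M] (R : StdRes Λ M) (x) : R.aug (R.d 0 x) = 0 := by
  have : R.d 0 x ∈ LinearMap.ker R.aug := by rw [R.exact0]; exact ⟨x, rfl⟩
  exact this

lemma ex0 {Λ : Type*} [Ring Λ] {M : Type*} [AddCommGroup M]
    [Module Λᵐᵒᵖ M] (R : StdRes Λ M) (x) (h : R.aug x = 0) : ∃ y, R.d 0 y = x := by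
  have : x ∈ LinearMap.ker R.aug := h
  rw [R.exact0] at this; exact this

lemma ex1 {Λ : Type*} [Ring Λ] {M : Type*} [AddCommGroup M]
    [Module Λᵐᵒᵖ M] (R : StdRes Λ M) (i : ℕ) (x) (h : R.d i x = 0) :
    ∃ y, R.d (i+1) y = x := by
  have : x ∈ LinearMap.ker (R.d i) := h
  rw [R.exact] at this; exact this

lemma exists_comparison {Λ : Type*} [Ring Λ] {M : Type*} [AddCommGroup M]
    [Module Λᵐᵒᵖ M] (R R' : StdRes Λ M) (φ : M →ₗ[Λᵐᵒᵖ] M) :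
    ∃ f : ∀ i, stdProj (R.E i) →ₗ[Λᵐᵒᵖ] stdProj (R'.E i),
      (∀ x, R'.aug (f 0 x) = φ (R.aug x)) ∧ ∀ i x, R'.d i (f (i+1) x) = f i (R.d i x) := by
  have : ∀ i, Module.Projective Λᵐᵒᵖ (stdProj (R.E i)) :=
    fun i => stdProj_projective _ (R.idem i)
  obtain ⟨b0, hb0⟩ := lift_range R'.aug (φ ∘ₗ R.aug) (fun x => R'.surj _)
  obtain ⟨b, hb, hb'⟩ := master (fun i => stdProj (R.E i)) (fun i => stdProj (R'.E i))
    R.d R'.d (fun _ => 0) (dd R) R'.exact (by simp) b0 (by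
      intro x
      refine ex0 R' _ ?_
      simp [hb0, augd])
  refine ⟨b, ?_, ?_⟩
  · intro x; rw [hb, hb0]; rfl
  · intro i x; rw [hb']; simp

lemma eTraceSum_lift {Λ : Type*} [Ring Λ] {M : Type*} [AddCommGroup M]
    [Module Λᵐᵒᵖ M] (e : Λ) (R : StdRes Λ M) (hR : R.EBounded e) (φ : M →ₗ[Λᵐᵒᵖ] M)
    (l l' : (i : ℕ) → (stdProj (R.E i) →ₗ[Λᵐᵒᵖ] stdProj (R.E i)))
    (hl : R.IsLifting φ l) (hl' : R.IsLifting φ l') :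
    eTraceSum e R l = eTraceSum e R l' := by
  have : ∀ i, Module.Projective Λᵐᵒᵖ (stdProj (R.E i)) :=
    fun i => stdProj_projective _ (R.idem i)
  obtain ⟨b0, hb0⟩ := lift_range (R.d 0) (l 0 - l' 0) (fun x => ex0 R _ (by
    simp [hl.1, hl'.1]))
  obtain ⟨b, hb, hb'⟩ := master (fun i => stdProj (R.E i)) (fun i => stdProj (R.E (i+1)))
    (fun i => - R.d i) (fun i => R.d (i+1)) (fun i => l (i+1) - l' (i+1))
    (by intro i x; simp [dd]) (fun i => R.exact (i+1))
    (by
      intro i x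
      simp only [LinearMap.sub_apply, map_sub, LinearMap.neg_apply, map_neg, hl.2, hl'.2]
      abel) b0 (by
      intro x
      refine ex1 R 0 _ ?_
      simp only [LinearMap.sub_apply, map_sub, LinearMap.neg_apply, map_neg, hl.2, hl'.2, hb0,
        map_add]
      abel)
  obtain ⟨n, hn⟩ := hR
  rw [eTraceSum_eq e R l n hn, eTraceSum_eq e R l' n hn]
  have h0 : l 0 = l' 0 + R.d 0 ∘ₗ b 0 := by
    ext1 x
    have := hb0 x
    rw [← hb] at this
    simp [this]
  have hsucc : ∀ i, l (i+1) = l' (i+1) + R.d (i+1) ∘ₗ b (i+1) + b i ∘ₗ R.d i := by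
    intro i
    ext1 x
    simp only [LinearMap.add_apply, LinearMap.comp_apply, hb', LinearMap.neg_apply, map_neg,
      LinearMap.sub_apply]
    abel
  have tel : ∀ m, ∑ i ∈ Finset.range (m+1), ((-1 : ℤ)^i) • etr e (R.idem i) (l i) =
      ∑ i ∈ Finset.range (m+1), ((-1 : ℤ)^i) • etr e (R.idem i) (l' i) +
        ((-1 : ℤ)^m) • etr e (R.idem m) (R.d m ∘ₗ b m) := by
    intro m
    induction m with
    | zero => simp [h0, etr_add]
    | succ m ih =>
      rw [Finset.sum_range_succ, ih, Finset.sum_range_succ _ (m+1), hsucc, etr_add, etr_add,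
        etr_comm e (R.idem (m+1)) (R.idem m) (R.d m) (b m), pow_succ]
      simp only [smul_add, mul_neg, mul_one, neg_smul]
      abel
  have h1 := tel n
  rw [Finset.sum_range_succ, Finset.sum_range_succ] at h1
  simpa only [etr_zero e (R.idem n) (hn n le_rfl), smul_zero, add_zero] using h1

lemma eTraceSum_indep {Λ : Type*} [Ring Λ] {M : Type*} [AddCommGroup M]
    [Module Λᵐᵒᵖ M] (e : Λ) (R R' : StdRes Λ M) (hR : R.EBounded e) (hR' : R'.EBounded e)
    (φ : M →ₗ[Λᵐᵒᵖ] M)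
    (l : (i : ℕ) → (stdProj (R.E i) →ₗ[Λᵐᵒᵖ] stdProj (R.E i)))
    (l' : (i : ℕ) → (stdProj (R'.E i) →ₗ[Λᵐᵒᵖ] stdProj (R'.E i)))
    (hl : R.IsLifting φ l) (hl' : R'.IsLifting φ l') :
    eTraceSum e R l = eTraceSum e R' l' := by
  obtain ⟨f, hf0, hf⟩ := exists_comparison R R' φ
  obtain ⟨g, hg0, hg⟩ := exists_comparison R' R LinearMap.id
  rw [eTraceSum_lift e R hR φ l (fun i => g i ∘ₗ f i) hl
      ⟨by intro x; simp [hg0, hf0], by intro i x; simp [hg, hf]⟩,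
    eTraceSum_lift e R' hR' φ l' (fun i => f i ∘ₗ g i) hl'
      ⟨by intro x; simp [hg0, hf0], by intro i x; simp [hg, hf]⟩]
  refine finsum_congr fun i => ?_
  rw [trP_comm (R.idem i) (R'.idem i)]

/-! ### Horseshoe -/

/-- direct sum of standard projectives -/
def stdAppend {Λ : Type*} [Ring Λ] {r s : ℕ} (e : Fin r → Λ) (f : Fin s → Λ) :
    (stdProj e × stdProj f) ≃ₗ[Λᵐᵒᵖ] stdProj (Fin.append e f) where
  toFun x := ⟨Fin.append (x.1 : Fin r → Λ) (x.2 : Fin s → Λ), by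
    intro j
    refine Fin.addCases (fun i => ?_) (fun i => ?_) j
    · simpa using stdProj_mem x.1 i
    · simpa using stdProj_mem x.2 i⟩
  invFun x := ⟨⟨fun i => (x : Fin (r+s) → Λ) (Fin.castAdd s i), fun i => by
      simpa using stdProj_mem x (Fin.castAdd s i)⟩,
    ⟨fun i => (x : Fin (r+s) → Λ) (Fin.natAdd r i), fun i => by
      simpa using stdProj_mem x (Fin.natAdd r i)⟩⟩
  map_add' x y := by
    ext j
    refine Fin.addCases (fun i => ?_) (fun i => ?_) j <;> simp
  map_smul' c x := by
    ext j
    refine Fin.addCases (fun i => ?_) (fun i => ?_) j <;> simp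
  left_inv x := by
    ext i <;> simp
  right_inv x := by
    ext j
    refine Fin.addCases (fun i => ?_) (fun i => ?_) j <;> simp

lemma append_idem {Λ : Type*} [Ring Λ] {r s : ℕ} {e : Fin r → Λ} {f : Fin s → Λ}
    (he : ∀ j, IsIdempotentElem (e j)) (hf : ∀ j, IsIdempotentElem (f j)) (j) :
    IsIdempotentElem (Fin.append e f j) := by
  refine Fin.addCases (fun i => ?_) (fun i => ?_) j
  · simpa using he i
  · simpa using hf i

/-- conjugate of an upper triangular block map -/
def tri {A : Type*} [Ring A] {P Q P' Q' : Type*} [AddCommGroup P] [Module A P]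
    [AddCommGroup Q] [Module A Q] [AddCommGroup P'] [Module A P'] [AddCommGroup Q'] [Module A Q']
    (a : P →ₗ[A] P') (b : Q →ₗ[A] P') (d : Q →ₗ[A] Q') : (P × Q) →ₗ[A] (P' × Q') :=
  LinearMap.prod (LinearMap.coprod a b) (d ∘ₗ LinearMap.snd A P Q)

lemma tri_apply {A : Type*} [Ring A] {P Q P' Q' : Type*} [AddCommGroup P] [Module A P]
    [AddCommGroup Q] [Module A Q] [AddCommGroup P'] [Module A P'] [AddCommGroup Q'] [Module A Q']
    (a : P →ₗ[A] P') (b : Q →ₗ[A] P') (d : Q →ₗ[A] Q') (x : P × Q) :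
    tri a b d x = (a x.1 + b x.2, d x.2) := rfl

lemma trP_tri {Λ : Type*} [Ring Λ] {r s : ℕ} {e : Fin r → Λ} {f : Fin s → Λ}
    (he : ∀ j, IsIdempotentElem (e j)) (hf : ∀ j, IsIdempotentElem (f j))
    (a : stdProj e →ₗ[Λᵐᵒᵖ] stdProj e) (b : stdProj f →ₗ[Λᵐᵒᵖ] stdProj e)
    (d : stdProj f →ₗ[Λᵐᵒᵖ] stdProj f) :
    trP (append_idem he hf) ((stdAppend e f).toLinearMap ∘ₗ tri a b d ∘ₗ
      (stdAppend e f).symm.toLinearMap) = trP he a + trP hf d := by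
  let S := (stdAppend e f).toLinearMap
  let T := (stdAppend e f).symm.toLinearMap
  let i1 := S ∘ₗ LinearMap.inl Λᵐᵒᵖ (stdProj e) (stdProj f)
  let i2 := S ∘ₗ LinearMap.inr Λᵐᵒᵖ (stdProj e) (stdProj f)
  let p1 := LinearMap.fst Λᵐᵒᵖ (stdProj e) (stdProj f) ∘ₗ T
  let p2 := LinearMap.snd Λᵐᵒᵖ (stdProj e) (stdProj f) ∘ₗ T
  have h : S ∘ₗ tri a b d ∘ₗ T = i1 ∘ₗ (a ∘ₗ p1) + i1 ∘ₗ (b ∘ₗ p2) + i2 ∘ₗ (d ∘ₗ p2) := by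
    ext1 x
    simp only [LinearMap.comp_apply, tri_apply, LinearMap.add_apply, i1, i2, p1, p2]
    rw [← map_add, ← map_add]
    simp
  have h11 : (a ∘ₗ p1) ∘ₗ i1 = a := by ext1 x; simp [p1, i1, S, T]
  have h21 : (b ∘ₗ p2) ∘ₗ i1 = 0 := by ext1 x; simp [p2, i1, S, T]
  have h22 : (d ∘ₗ p2) ∘ₗ i2 = d := by ext1 x; simp [p2, i2, S, T]
  change trP (append_idem he hf) (S ∘ₗ tri a b d ∘ₗ T) = _
  rw [h, trP_add, trP_add, trP_comm (append_idem he hf) he, trP_comm (append_idem he hf) he,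
    trP_comm (append_idem he hf) hf, h11, h21, h22, trP_zero, add_zero]

lemma horseshoe {Λ : Type*} [Ring Λ] {L M N : Type*} [AddCommGroup L] [Module Λᵐᵒᵖ L]
    [AddCommGroup M] [Module Λᵐᵒᵖ M] [AddCommGroup N] [Module Λᵐᵒᵖ N]
    (u : L →ₗ[Λᵐᵒᵖ] M) (v : M →ₗ[Λᵐᵒᵖ] N)
    (hu : Function.Injective u) (hv : Function.Surjective v)
    (huv : LinearMap.ker v = LinearMap.range u)
    (φL : L →ₗ[Λᵐᵒᵖ] L) (φM : M →ₗ[Λᵐᵒᵖ] M) (φN : N →ₗ[Λᵐᵒᵖ] N)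
    (hcomm₁ : ∀ x, u (φL x) = φM (u x)) (hcomm₂ : ∀ x, v (φM x) = φN (v x))
    (RL : StdRes Λ L) (RN : StdRes Λ N) :
    ∃ RM : StdRes Λ M, (∀ e, RL.EBounded e → RN.EBounded e → RM.EBounded e) ∧
      ∀ (lL : (i : ℕ) → (stdProj (RL.E i) →ₗ[Λᵐᵒᵖ] stdProj (RL.E i)))
        (lN : (i : ℕ) → (stdProj (RN.E i) →ₗ[Λᵐᵒᵖ] stdProj (RN.E i))),
        RL.IsLifting φL lL → RN.IsLifting φN lN →
        ∃ lM : (i : ℕ) → (stdProj (RM.E i) →ₗ[Λᵐᵒᵖ] stdProj (RM.E i)),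
          RM.IsLifting φM lM ∧
          ∀ i, trP (RM.idem i) (lM i) = trP (RL.idem i) (lL i) + trP (RN.idem i) (lN i) := by
  have : ∀ i, Module.Projective Λᵐᵒᵖ (stdProj (RL.E i)) :=
    fun i => stdProj_projective _ (RL.idem i)
  have : ∀ i, Module.Projective Λᵐᵒᵖ (stdProj (RN.E i)) :=
    fun i => stdProj_projective _ (RN.idem i)
  have hvu : ∀ x, v (u x) = 0 := fun x => by
    have : u x ∈ LinearMap.ker v := by rw [huv]; exact ⟨x, rfl⟩
    exact this
  have hex : ∀ m, v m = 0 → ∃ x, (u ∘ₗ RL.aug) x = m := fun m hm => by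
    have : m ∈ LinearMap.ker v := hm
    rw [huv] at this
    obtain ⟨y, rfl⟩ := this
    obtain ⟨x, rfl⟩ := RL.surj y
    exact ⟨x, rfl⟩
  obtain ⟨σ, hσ⟩ := lift_range v RN.aug (fun x => hv _)
  obtain ⟨θ0, hθ0⟩ := lift_range (u ∘ₗ RL.aug) (-(σ ∘ₗ RN.d 0)) (fun x => hex _ (by
    simp [hσ, augd]))
  simp only [LinearMap.comp_apply, LinearMap.neg_apply] at hθ0
  obtain ⟨θ, hθz, hθ⟩ := master (fun i => stdProj (RN.E (i+1))) (fun i => stdProj (RL.E i))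
    (fun i => - RN.d (i+1)) RL.d (fun _ => 0) (by intro i x; simp [dd]) RL.exact (by simp) θ0
    (by
      intro x
      refine ex0 RL _ (hu ?_)
      simp [hθ0, dd])
  subst hθz
  simp only [LinearMap.neg_apply, map_neg, LinearMap.zero_apply, add_zero] at hθ
  let S := fun i => stdAppend (RL.E i) (RN.E i)
  let D := fun i => tri (RL.d i) (θ i) (RN.d i)
  let α : (stdProj (RL.E 0) × stdProj (RN.E 0)) →ₗ[Λᵐᵒᵖ] M := LinearMap.coprod (u ∘ₗ RL.aug) σ
  have hα : ∀ x, α x = u (RL.aug x.1) + σ x.2 := fun x => rfl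
  have hD : ∀ i x, D i x = (RL.d i x.1 + θ i x.2, RN.d i x.2) := fun i x => rfl
  let RM : StdRes Λ M :=
    { n := fun i => RL.n i + RN.n i
      E := fun i => Fin.append (RL.E i) (RN.E i)
      idem := fun i => append_idem (RL.idem i) (RN.idem i)
      d := fun i => (S i).toLinearMap ∘ₗ D i ∘ₗ (S (i+1)).symm.toLinearMap
      aug := α ∘ₗ (S 0).symm.toLinearMap
      surj := by
        intro m
        obtain ⟨y, hy⟩ := RN.surj (v m)
        obtain ⟨x, hx⟩ := hex (m - σ y) (by rw [map_sub, hσ, hy, sub_self])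
        refine ⟨S 0 (x, y), ?_⟩
        simp only [LinearMap.comp_apply] at hx
        simp [hα, hx]
      exact0 := by
        ext z
        obtain ⟨⟨x, y⟩, rfl⟩ := (S 0).surjective z
        constructor
        · intro h
          replace h : u (RL.aug x) + σ y = 0 := by simpa [hα] using h
          have hy : RN.aug y = 0 := by
            have := congrArg v h
            simpa [hvu, hσ] using this
          obtain ⟨y', rfl⟩ := ex0 RN y hy
          obtain ⟨x', hx'⟩ := ex0 RL (x - θ 0 y') (hu (by
            rw [map_sub, map_sub, hθ0, sub_neg_eq_add, h, map_zero]))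
          exact ⟨S 1 (x', y'), by simp [hD, hx']⟩
        · rintro ⟨w, hw⟩
          obtain ⟨⟨x', y'⟩, rfl⟩ := (S 1).surjective w
          rw [← hw]
          simp [hD, hα, hθ0, augd]
      exact := by
        intro i
        ext z
        obtain ⟨⟨x, y⟩, rfl⟩ := (S (i+1)).surjective z
        constructor
        · intro h
          replace h : RL.d i x + θ i y = 0 ∧ RN.d i y = 0 := by
            simpa [hD] using h
          obtain ⟨y', rfl⟩ := ex1 RN i y h.2
          obtain ⟨x', hx'⟩ := ex1 RL i (x - θ (i+1) y') (by
            rw [map_sub, hθ, sub_neg_eq_add, h.1])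
          exact ⟨S (i+1+1) (x', y'), by simp [hD, hx']⟩
        · rintro ⟨w, hw⟩
          obtain ⟨⟨x', y'⟩, rfl⟩ := (S (i+1+1)).surjective w
          rw [← hw]
          simp [hD, hθ, dd] }
  refine ⟨RM, ?_, ?_⟩
  · rintro e ⟨n, hn⟩ ⟨m, hm⟩
    refine ⟨max n m, fun i hi j => ?_⟩
    change ∀ x, Fin.append (RL.E i) (RN.E i) j * x * e ∈ Jset Λ
    refine Fin.addCases (fun k => ?_) (fun k => ?_) j
    · simpa using hn i (le_trans (le_max_left _ _) hi) k
    · simpa using hm i (le_trans (le_max_right _ _) hi) k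
  · intro lL lN hL hN
    obtain ⟨b0, hb0⟩ := lift_range (u ∘ₗ RL.aug) (φM ∘ₗ σ - σ ∘ₗ lN 0) (fun x => hex _ (by
      simp [hcomm₂, hσ, hN.1]))
    simp only [LinearMap.comp_apply, LinearMap.sub_apply] at hb0
    obtain ⟨b, hbz, hb⟩ := master (fun i => stdProj (RN.E i)) (fun i => stdProj (RL.E i))
      RN.d RL.d (fun i => lL i ∘ₗ θ i - θ i ∘ₗ lN (i+1)) (dd RN) RL.exact
      (by
        intro i x
        simp [hL.2, hN.2, hθ]) b0
      (by
        intro x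
        refine ex0 RL _ (hu ?_)
        simp [hb0, hL.1, hcomm₁, hθ0, hN.2])
    subst hbz
    simp only [LinearMap.comp_apply, LinearMap.sub_apply] at hb
    refine ⟨fun i => (S i).toLinearMap ∘ₗ tri (lL i) (b i) (lN i) ∘ₗ (S i).symm.toLinearMap,
      ⟨?_, ?_⟩, fun i => trP_tri _ _ _ _ _⟩
    · intro z
      obtain ⟨⟨x, y⟩, rfl⟩ := (S 0).surjective z
      simp [RM, tri_apply, hα, hL.1, hcomm₁, hb0]
      abel
    · intro i z
      obtain ⟨⟨x, y⟩, rfl⟩ := (S (i+1)).surjective z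
      simp only [RM, tri_apply, hD, LinearMap.comp_apply, LinearEquiv.coe_coe,
        LinearEquiv.symm_apply_apply]
      congr 2
      · simp only [map_add, hL.2, hb]
        abel
      · exact hN.2 i y

end helpers

/-- Proposition 1.4: given a commutative diagram with exact rows 0 → L → M → N → 0 of
finitely generated modules over an artin algebra Λ, with vertical endomorphisms
φ_L, φ_M, φ_N, if L and N admit e-bounded projective resolutions then so does M, and
tr_e(φ_M) = tr_e(φ_L) + tr_e(φ_N), where tr_e is computed as the alternating sum of the
e-traces of any lifting to any e-bounded projective resolution. -/
theorem etrace_additive_on_ses (k : Type*) [CommRing k] [IsArtinianRing k]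
    (Λ : Type*) [Ring Λ] [Algebra k Λ] [Module.Finite k Λ]
    (e : Λ) (he : IsIdempotentElem e)
    (L M N : Type*) [AddCommGroup L] [Module Λᵐᵒᵖ L] [Module.Finite Λᵐᵒᵖ L]
    [AddCommGroup M] [Module Λᵐᵒᵖ M] [Module.Finite Λᵐᵒᵖ M]
    [AddCommGroup N] [Module Λᵐᵒᵖ N] [Module.Finite Λᵐᵒᵖ N]
    (u : L →ₗ[Λᵐᵒᵖ] M) (v : M →ₗ[Λᵐᵒᵖ] N)
    (hu : Function.Injective u) (hv : Function.Surjective v)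
    (huv : LinearMap.ker v = LinearMap.range u)
    (φL : L →ₗ[Λᵐᵒᵖ] L) (φM : M →ₗ[Λᵐᵒᵖ] M) (φN : N →ₗ[Λᵐᵒᵖ] N)
    (hcomm₁ : ∀ x, u (φL x) = φM (u x)) (hcomm₂ : ∀ x, v (φM x) = φN (v x))
    (hL : ∃ RL : StdRes Λ L, RL.EBounded e) (hN : ∃ RN : StdRes Λ N, RN.EBounded e) :
    (∃ RM : StdRes Λ M, RM.EBounded e) ∧
    ∀ (RL : StdRes Λ L) (RM : StdRes Λ M) (RN : StdRes Λ N),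
      RL.EBounded e → RM.EBounded e → RN.EBounded e →
      ∀ (lL : (i : ℕ) → (stdProj (RL.E i) →ₗ[Λᵐᵒᵖ] stdProj (RL.E i)))
        (lM : (i : ℕ) → (stdProj (RM.E i) →ₗ[Λᵐᵒᵖ] stdProj (RM.E i)))
        (lN : (i : ℕ) → (stdProj (RN.E i) →ₗ[Λᵐᵒᵖ] stdProj (RN.E i))),
        RL.IsLifting φL lL → RM.IsLifting φM lM → RN.IsLifting φN lN →
        eTraceSum e RM lM = eTraceSum e RL lL + eTraceSum e RN lN := by
  constructor
  · obtain ⟨RL, hRL⟩ := hL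
    obtain ⟨RN, hRN⟩ := hN
    obtain ⟨RM, hRM, -⟩ := horseshoe u v hu hv huv φL φM φN hcomm₁ hcomm₂ RL RN
    exact ⟨RM, hRM e hRL hRN⟩
  · intro RL RM RN hRL hRM hRN lL lM lN hlL hlM hlN
    obtain ⟨RH, hRH, hH⟩ := horseshoe u v hu hv huv φL φM φN hcomm₁ hcomm₂ RL RN
    obtain ⟨lH, hlH, htr⟩ := hH lL lN hlL hlN
    rw [eTraceSum_indep e RM RH hRM (hRH e hRL hRN) φM lM lH hlM hlH]
    obtain ⟨n₁, h₁⟩ := hRL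
    obtain ⟨n₂, h₂⟩ := hRN
    obtain ⟨n₃, h₃⟩ := hRH e ⟨n₁, h₁⟩ ⟨n₂, h₂⟩
    rw [eTraceSum_eq e RH lH (n₁ + n₂ + n₃) (fun i hi => h₃ i (by omega)),
      eTraceSum_eq e RL lL (n₁ + n₂ + n₃) (fun i hi => h₁ i (by omega)),
      eTraceSum_eq e RN lN (n₁ + n₂ + n₃) (fun i hi => h₂ i (by omega)),
      ← Finset.sum_add_distrib]
    refine Finset.sum_congr rfl fun i _ => ?_
    simp only [etr, htr, map_add]
    exact zsmul_add _ _ _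
end

section
/- Let Λ be an artin algebra with Jacobson radical J and e an idempotent of Λ. If the semisimple module S_e = eΛ/eJ has finite injective dimension, then the Jacobson radical of Λ_e = Λ/Λ(1−e)Λ is contained in the commutator subgroup [Λ_e, Λ_e]; that is, HH₀(Λ_e) is radical-trivial. -/
universe u

/-- The square J² of the Jacobson radical, as an additive subgroup. -/
def Jsq (Λ : Type*) [Ring Λ] : AddSubgroup Λ :=
  AddSubgroup.closure {x | ∃ a ∈ Jset Λ, ∃ b ∈ Jset Λ, x = a * b}

/-- The right ideal eΛ as a Λᵐᵒᵖ-submodule of Λ. -/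
def eSub (Λ : Type*) [Ring Λ] (e : Λ) : Submodule Λᵐᵒᵖ Λ where
  carrier := {x | e * x = x}
  add_mem' := by intro x y hx hy; simp only [Set.mem_setOf_eq] at *; rw [mul_add, hx, hy]
  zero_mem' := by simp
  smul_mem' := by
    intro c x hx
    simp only [Set.mem_setOf_eq, MulOpposite.smul_eq_mul_unop, ← mul_assoc] at *
    rw [hx]

/-- The semisimple right Λ-module S_e = eΛ/eJ. -/
abbrev SeMod (Λ : Type*) [Ring Λ] (e : Λ) :=
  (eSub Λ e) ⧸ (Submodule.span Λᵐᵒᵖ {x : eSub Λ e | (x : Λ) ∈ Jset Λ})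

/-- A right Λ-module M has finite injective dimension: it admits a finite injective
coresolution 0 → M → I⁰ → I¹ → ⋯ with Iⁱ = 0 for all large i. -/
def FinInjDim (Λ : Type u) [Ring Λ] (M : Type u) [AddCommGroup M] [Module Λᵐᵒᵖ M] : Prop :=
  ∃ (I : ℕ → ModuleCat.{u} Λᵐᵒᵖ) (f : ∀ i, I i →ₗ[Λᵐᵒᵖ] I (i+1)) (g : M →ₗ[Λᵐᵒᵖ] I 0),
    (∀ i, Module.Injective Λᵐᵒᵖ (I i)) ∧ Function.Injective g ∧
    LinearMap.ker (f 0) = LinearMap.range g ∧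
    (∀ i, LinearMap.ker (f (i+1)) = LinearMap.range (f i)) ∧
    ∃ N, ∀ i ≥ N, Subsingleton (I i)

/-- A right Λ-module M has finite projective dimension: it admits a finite projective
resolution ⋯ → P₁ → P₀ → M → 0 with Pᵢ = 0 for all large i. -/
def FinProjDim (Λ : Type u) [Ring Λ] (M : Type u) [AddCommGroup M] [Module Λᵐᵒᵖ M] : Prop :=
  ∃ (P : ℕ → ModuleCat.{u} Λᵐᵒᵖ) (f : ∀ i, P (i+1) →ₗ[Λᵐᵒᵖ] P i) (g : P 0 →ₗ[Λᵐᵒᵖ] M),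
    (∀ i, Module.Projective Λᵐᵒᵖ (P i)) ∧ Function.Surjective g ∧
    LinearMap.ker g = LinearMap.range (f 0) ∧
    (∀ i, LinearMap.ker (f i) = LinearMap.range (f (i+1))) ∧
    ∃ N, ∀ i ≥ N, Subsingleton (P i)

/-- Ext¹_Λ(S,S) = 0, expressed as: every short exact sequence 0 → S → E → S → 0 of right
Λ-modules splits. -/
def Ext1SelfVanishes (Λ : Type u) [Ring Λ] (S : Type u) [AddCommGroup S]
    [Module Λᵐᵒᵖ S] : Prop :=
  ∀ (E : Type u) [AddCommGroup E] [Module Λᵐᵒᵖ E]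
    (i : S →ₗ[Λᵐᵒᵖ] E) (p : E →ₗ[Λᵐᵒᵖ] S),
    Function.Injective i → Function.Surjective p → LinearMap.ker p = LinearMap.range i →
    ∃ r : E →ₗ[Λᵐᵒᵖ] S, ∀ x, r (i x) = x

/-- An idempotent u is primitive if it is nonzero and is not the sum of two orthogonal
nonzero idempotents. -/
def IsPrimitiveIdem {Λ : Type*} [Ring Λ] (u : Λ) : Prop :=
  u ≠ 0 ∧ IsIdempotentElem u ∧ ∀ f g : Λ, IsIdempotentElem f → IsIdempotentElem g →
    f * g = 0 → g * f = 0 → f + g = u → f = 0 ∨ g = 0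

/-- A primitive idempotent e is basic if eΛ is not isomorphic to a direct summand of
(1-e)Λ; equivalently, there are no u ∈ eΛ(1-e), v ∈ (1-e)Λe with uv = e. -/
def IsBasicIdem {Λ : Type*} [Ring Λ] (e : Λ) : Prop :=
  IsPrimitiveIdem e ∧
    ¬ ∃ u v : Λ, u = e * u * (1 - e) ∧ v = (1 - e) * v * e ∧ u * v = e


section TraceTheory

/-- The zeroth Hochschild homology group. -/
abbrev HHz (B : Type u) [Ring B] := B ⧸ commSub B

lemma HHz_mul_comm {B : Type u} [Ring B] (x y : B) :
    (QuotientAddGroup.mk' (commSub B)) (x * y) = (QuotientAddGroup.mk' (commSub B)) (y * x) := by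
  rw [← sub_eq_zero, ← map_sub]
  simp only [QuotientAddGroup.mk'_apply, QuotientAddGroup.eq_zero_iff]
  exact AddSubgroup.subset_closure ⟨x, y, rfl⟩

/-- Trace data on a module: a finite dual basis for the maps to `B`. -/
structure TD (A B : Type u) [Ring A] [Ring B] [Module A B]
    (M : Type u) [AddCommGroup M] [Module A M] where
  n : ℕ
  b : Fin n → M
  a : Fin n → M →ₗ[A] B
  h : ∀ (q : M →ₗ[A] B) (y : M), q y = ∑ j, a j y * q (b j)

variable {A B : Type u} [Ring A] [Ring B] [Module A B]

/-- The trace attached to trace data. -/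
def TD.tr {M : Type u} [AddCommGroup M] [Module A M] (d : TD A B M) (φ : M →ₗ[A] M) : HHz B :=
  ∑ j, QuotientAddGroup.mk' (commSub B) (d.a j (φ (d.b j)))

lemma TD.tr_add {M : Type u} [AddCommGroup M] [Module A M] (d : TD A B M) (φ ψ : M →ₗ[A] M) :
    d.tr (φ + ψ) = d.tr φ + d.tr ψ := by
  simp only [TD.tr, LinearMap.add_apply, map_add, Finset.sum_add_distrib]

lemma TD.tr_cyc {M L : Type u} [AddCommGroup M] [Module A M] [AddCommGroup L] [Module A L]
    (d : TD A B M) (d' : TD A B L) (f : M →ₗ[A] L) (g : L →ₗ[A] M) :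
    d.tr (g ∘ₗ f) = d'.tr (f ∘ₗ g) := by
  have h1 : ∀ i, d.a i (g (f (d.b i))) = ∑ j, d'.a j (f (d.b i)) * d.a i (g (d'.b j)) := by
    intro i
    exact d'.h ((d.a i) ∘ₗ g) (f (d.b i))
  have h2 : ∀ j, d'.a j (f (g (d'.b j))) = ∑ i, d.a i (g (d'.b j)) * d'.a j (f (d.b i)) := by
    intro j
    exact d.h ((d'.a j) ∘ₗ f) (g (d'.b j))
  simp only [TD.tr, LinearMap.comp_apply, h1, h2, map_sum]
  rw [Finset.sum_comm]
  refine Finset.sum_congr rfl fun j _ => Finset.sum_congr rfl fun i _ => HHz_mul_comm _ _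

/-- Trace data on a free module. -/
def TD.free [IsScalarTower A B B] (m : ℕ) : TD A B (Fin m → A) where
  n := m
  b := fun j => Pi.single j 1
  a := fun j => (LinearMap.toSpanSingleton A B 1) ∘ₗ (LinearMap.proj j)
  h := by
    intro q y
    conv_lhs => rw [pi_eq_sum_univ' y]
    rw [map_sum]
    refine Finset.sum_congr rfl fun j _ => ?_
    rw [map_smul]
    simp only [LinearMap.comp_apply, LinearMap.toSpanSingleton_apply, LinearMap.proj_apply,
      smul_mul_assoc, one_mul]

/-- A trace theory on a class of modules. -/
structure TrTheory (A B : Type u) [Ring A] [Ring B] [Module A B] [IsScalarTower A B B]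
    (X : ∀ (M : Type u) [AddCommGroup M] [Module A M], Prop) where
  tr : ∀ (M : Type u) [AddCommGroup M] [Module A M], X M → (M →ₗ[A] M) → HHz B
  add : ∀ (M : Type u) [AddCommGroup M] [Module A M] (h : X M) (φ ψ : M →ₗ[A] M),
    tr M h (φ + ψ) = tr M h φ + tr M h ψ
  cyc : ∀ (M L : Type u) [AddCommGroup M] [Module A M] [AddCommGroup L] [Module A L]
    (h : X M) (h' : X L) (f : M →ₗ[A] L) (g : L →ₗ[A] M),
    tr M h (g ∘ₗ f) = tr L h' (f ∘ₗ g)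
  triv : ∀ (M : Type u) [AddCommGroup M] [Module A M], Subsingleton M → X M
  free : ∀ m, X (Fin m → A)
  free_tr : ∀ m (h : X (Fin m → A)) (φ : (Fin m → A) →ₗ[A] (Fin m → A)),
    tr _ h φ = (TD.free (B := B) m).tr φ

/-- The class at level zero. -/
def X0 (A B : Type u) [Ring A] [Ring B] [Module A B]
    (M : Type u) [AddCommGroup M] [Module A M] : Prop := Nonempty (TD A B M)

/-- The next class. -/
def Xsucc (A : Type u) [Ring A] (X : ∀ (M : Type u) [AddCommGroup M] [Module A M], Prop)
    (M : Type u) [AddCommGroup M] [Module A M] : Prop :=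
  ∃ (m : ℕ) (p : (Fin m → A) →ₗ[A] M), Function.Surjective p ∧ X (LinearMap.ker p)

/-- The base trace theory. -/
noncomputable def theory0 [IsScalarTower A B B] : TrTheory A B (X0 A B) where
  tr := fun M _ _ h φ => (Classical.choice h).tr φ
  add := fun M _ _ h φ ψ => TD.tr_add _ _ _
  cyc := fun M L _ _ _ _ h h' f g => TD.tr_cyc _ _ _ _
  triv := fun M _ _ hM => ⟨⟨0, Fin.elim0, Fin.elim0, fun q y => by
    rw [Subsingleton.elim y 0]; simp⟩⟩
  free := fun m => ⟨TD.free m⟩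
  free_tr := fun m h φ => by
    simpa using TD.tr_cyc (Classical.choice h) (TD.free (B := B) m) φ LinearMap.id

variable [IsScalarTower A B B] {X : ∀ (M : Type u) [AddCommGroup M] [Module A M], Prop}

lemma TrTheory.sub (T : TrTheory A B X) (M : Type u) [AddCommGroup M] [Module A M] (h : X M)
    (φ ψ : M →ₗ[A] M) : T.tr M h (φ - ψ) = T.tr M h φ - T.tr M h ψ := by
  rw [eq_sub_iff_add_eq, ← T.add, sub_add_cancel]

lemma TrTheory.zero (T : TrTheory A B X) (M : Type u) [AddCommGroup M] [Module A M] (h : X M) :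
    T.tr M h 0 = 0 := by
  have := T.sub M h 0 0
  simpa using this

/-- Two compatible pairs of endomorphisms give the same difference of traces. -/
lemma TrTheory.indep (T : TrTheory A B X) {M : Type u} [AddCommGroup M] [Module A M] {m : ℕ}
    (p : (Fin m → A) →ₗ[A] M) (hK : X (LinearMap.ker p))
    (φ ψ : (Fin m → A) →ₗ[A] (Fin m → A)) (φ' ψ' : LinearMap.ker p →ₗ[A] LinearMap.ker p)
    (hφ : ∀ x, (φ' x : Fin m → A) = φ x) (hψ : ∀ x, (ψ' x : Fin m → A) = ψ x)
    (hp : p ∘ₗ φ = p ∘ₗ ψ) :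
    (TD.free (B := B) m).tr φ - T.tr _ hK φ' = (TD.free (B := B) m).tr ψ - T.tr _ hK ψ' := by
  let h : (Fin m → A) →ₗ[A] LinearMap.ker p := (φ - ψ).codRestrict (LinearMap.ker p) (by
    intro x
    have := LinearMap.congr_fun hp x
    simp only [LinearMap.comp_apply] at this
    simp [this])
  have e1 : φ - ψ = (LinearMap.ker p).subtype ∘ₗ h := by ext; rfl
  have e2 : φ' - ψ' = h ∘ₗ (LinearMap.ker p).subtype := by
    ext x : 2
    simp [h, hφ, hψ]
  have := T.cyc _ _ (T.free m) hK h (LinearMap.ker p).subtype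
  rw [← e1, ← e2, T.sub, T.sub, T.free_tr, T.free_tr] at this
  rw [sub_eq_sub_iff_sub_eq_sub, this]

lemma exists_lift {M L : Type u} [AddCommGroup M] [Module A M] [AddCommGroup L] [Module A L]
    {m n : ℕ} (p : (Fin m → A) →ₗ[A] M) (q : (Fin n → A) →ₗ[A] L) (hq : Function.Surjective q)
    (f : M →ₗ[A] L) : ∃ (F : (Fin m → A) →ₗ[A] (Fin n → A))
      (F' : LinearMap.ker p →ₗ[A] LinearMap.ker q),
      q ∘ₗ F = f ∘ₗ p ∧ ∀ x, (F' x : Fin n → A) = F x := by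
  obtain ⟨F, hF⟩ := Module.projective_lifting_property q (f ∘ₗ p) hq
  refine ⟨F, F.restrict (fun x hx => ?_), hF, fun x => rfl⟩
  have := LinearMap.congr_fun hF x
  simp only [LinearMap.comp_apply] at this
  rw [LinearMap.mem_ker] at hx ⊢
  rw [this, hx, map_zero]

/-- The trace at the next level. -/
noncomputable def succTr (T : TrTheory A B X) (M : Type u) [AddCommGroup M] [Module A M]
    (h : Xsucc A X M) (φ : M →ₗ[A] M) : HHz B :=
  let p := h.choose_spec.choose
  let hp := h.choose_spec.choose_spec
  let L := exists_lift p p hp.1 φ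
  (TD.free (B := B) h.choose).tr L.choose - T.tr _ hp.2 L.choose_spec.choose

lemma succTr_spec (T : TrTheory A B X) (M : Type u) [AddCommGroup M] [Module A M]
    (h : Xsucc A X M) : ∃ (m : ℕ) (p : (Fin m → A) →ₗ[A] M) (_ : Function.Surjective p)
      (hK : X (LinearMap.ker p)), ∀ (φ : M →ₗ[A] M) (F : (Fin m → A) →ₗ[A] (Fin m → A))
      (F' : LinearMap.ker p →ₗ[A] LinearMap.ker p), p ∘ₗ F = φ ∘ₗ p →
      (∀ x, (F' x : Fin m → A) = F x) →
      succTr T M h φ = (TD.free (B := B) m).tr F - T.tr _ hK F' := by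
  refine ⟨h.choose, h.choose_spec.choose, h.choose_spec.choose_spec.1,
    h.choose_spec.choose_spec.2, ?_⟩
  intro φ F F' hF hF'
  have hL := (exists_lift h.choose_spec.choose _ h.choose_spec.choose_spec.1 φ).choose_spec.choose_spec
  exact T.indep _ _ _ _ _ _ hL.2 hF' (hL.1.trans hF.symm)

/-- The trace theory at the next level. -/
noncomputable def TrTheory.succ (T : TrTheory A B X) : TrTheory A B (Xsucc A X) where
  tr := fun M _ _ h φ => succTr T M h φ
  add := by
    intro M _ _ h φ ψ
    obtain ⟨m, p, hp, hK, H⟩ := succTr_spec T M h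
    obtain ⟨F, F', hF, hF'⟩ := exists_lift p p hp φ
    obtain ⟨G, G', hG, hG'⟩ := exists_lift p p hp ψ
    rw [H φ F F' hF hF', H ψ G G' hG hG', H (φ + ψ) (F + G) (F' + G')
      (by rw [LinearMap.comp_add, hF, hG, LinearMap.add_comp]) (by intro x; simp [hF', hG']),
      TD.tr_add, T.add]
    abel
  cyc := by
    intro M L _ _ _ _ h h' f g
    obtain ⟨m, p, hp, hK, H⟩ := succTr_spec T M h
    obtain ⟨n, q, hq, hK', H'⟩ := succTr_spec T L h'
    obtain ⟨F, F', hF, hF'⟩ := exists_lift p q hq f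
    obtain ⟨G, G', hG, hG'⟩ := exists_lift q p hp g
    rw [H (g ∘ₗ f) (G ∘ₗ F) (G' ∘ₗ F')
        (by rw [← LinearMap.comp_assoc, hG, LinearMap.comp_assoc, hF, LinearMap.comp_assoc])
        (by intro x; simp [hF', hG']),
      H' (f ∘ₗ g) (F ∘ₗ G) (F' ∘ₗ G')
        (by rw [← LinearMap.comp_assoc, hF, LinearMap.comp_assoc, hG, LinearMap.comp_assoc])
        (by intro x; simp [hF', hG']),
      TD.tr_cyc _ (TD.free n), T.cyc _ _ hK hK']
  triv := by
    intro M _ _ hM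
    refine ⟨0, 0, fun x => ⟨0, Subsingleton.elim _ _⟩, T.triv _ ?_⟩
    infer_instance
  free := by
    intro m
    refine ⟨m, LinearMap.id, fun x => ⟨x, rfl⟩, T.triv _ ?_⟩
    rw [LinearMap.ker_id]
    infer_instance
  free_tr := by
    intro m h φ
    obtain ⟨r, p, hp, hK, H⟩ := succTr_spec T _ h
    obtain ⟨s, hs⟩ := Module.projective_lifting_property p LinearMap.id hp
    rw [H φ (s ∘ₗ φ ∘ₗ p) 0
      (by rw [← LinearMap.comp_assoc, hs, LinearMap.id_comp]) (by intro x; simp),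
      T.zero, sub_zero, TD.tr_cyc _ (TD.free m), LinearMap.comp_assoc, hs, LinearMap.comp_id]

/-- The iterated classes. -/
def Xn (A B : Type u) [Ring A] [Ring B] [Module A B] :
    ℕ → ∀ (M : Type u) [AddCommGroup M] [Module A M], Prop
  | 0 => X0 A B
  | n + 1 => Xsucc A (Xn A B n)

/-- The iterated trace theories. -/
noncomputable def theoryN : ∀ n, TrTheory A B (Xn A B n)
  | 0 => theory0
  | n + 1 => (theoryN n).succ

lemma TrTheory.nilp (T : TrTheory A B X) [IsNoetherianRing A]
    (hX : ∀ (M : Type u) [AddCommGroup M] [Module A M] [Module.Finite A M], X M) (n : ℕ) :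
    ∀ (M : Type u) [AddCommGroup M] [Module A M] [Module.Finite A M] (h : X M)
    (φ : M →ₗ[A] M), φ ^ n = 0 → T.tr M h φ = 0 := by
  induction n with
  | zero =>
    intro M _ _ _ h φ h0
    have : φ = 0 := by
      have : (1 : M →ₗ[A] M) = 0 := by simpa using h0
      rw [← mul_one φ, this, mul_zero]
    rw [this, T.zero]
  | succ n ih =>
    intro M _ _ _ h φ h0
    have e : φ = (LinearMap.range φ).subtype ∘ₗ φ.rangeRestrict := by ext; rfl
    conv_lhs => rw [e]
    rw [T.cyc _ _ h (hX _)]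
    apply ih
    have key : ∀ k (y : LinearMap.range φ),
        (((φ.rangeRestrict ∘ₗ (LinearMap.range φ).subtype) ^ k) y : M) = (φ ^ k) (y : M) := by
      intro k
      induction k with
      | zero => intro y; simp
      | succ k ihk => intro y; rw [pow_succ, pow_succ, Module.End.mul_apply, ihk]; rfl
    ext ⟨_, x, rfl⟩
    rw [key]
    have := LinearMap.congr_fun h0 x
    rw [pow_succ] at this
    simpa using this

end TraceTheory

section ExtPart

open CategoryTheory

variable {A B : Type u} [Ring A] [Ring B] [Module A B]

/-- The short complex attached to a surjection. -/
abbrev kerSC {M N : Type u} [AddCommGroup M] [Module A M] [AddCommGroup N] [Module A N]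
    (p : M →ₗ[A] N) : ShortComplex (ModuleCat.{u} A) :=
  ShortComplex.mk (ModuleCat.ofHom (LinearMap.ker p).subtype) (ModuleCat.ofHom p) (by
    ext x; exact x.2)

lemma kerSC_exact {M N : Type u} [AddCommGroup M] [Module A M] [AddCommGroup N] [Module A N]
    (p : M →ₗ[A] N) (hp : Function.Surjective p) : (kerSC p).ShortExact where
  exact := by
    rw [ShortComplex.moduleCat_exact_iff]
    intro x hx
    exact ⟨⟨x, hx⟩, rfl⟩
  mono_f := by
    rw [ModuleCat.mono_iff_injective]
    exact Subtype.val_injective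
  epi_g := by
    rw [ModuleCat.epi_iff_surjective]
    exact hp

/-- Vanishing of Ext into submodules of free `B`-modules. -/
def DD (A B : Type u) [Ring A] [Ring B] [Module A B] (n : ℕ)
    (K : Type u) [AddCommGroup K] [Module A K] : Prop :=
  ∀ (m : ℕ) (Z : Submodule A (Fin m → B))
    (x : Abelian.Ext (ModuleCat.of A K) (ModuleCat.of A Z) (n + 1)), x = 0

lemma DD_ker {n : ℕ} {K P : Type u} [AddCommGroup K] [Module A K] [AddCommGroup P] [Module A P]
    [Module.Projective A P] (p : P →ₗ[A] K) (hp : Function.Surjective p)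
    (h : DD A B (n + 1) K) : DD A B n (LinearMap.ker p) := by
  intro m Z x
  obtain ⟨y, hy⟩ := Abelian.Ext.contravariant_sequence_exact₁ (kerSC_exact p hp) _ x
    (n₁ := n + 1 + 1) (by omega) (h m Z _)
  have : Projective (ModuleCat.of A P) := inferInstance
  rw [← hy, Abelian.Ext.eq_zero_of_projective y, Abelian.Ext.comp_zero]

lemma exists_lift_of_ext {K W V : Type u} [AddCommGroup K] [Module A K] [AddCommGroup W]
    [Module A W] [AddCommGroup V] [Module A V] (p : W →ₗ[A] V) (hp : Function.Surjective p)
    (h : ∀ x : Abelian.Ext (ModuleCat.of A K) (ModuleCat.of A (LinearMap.ker p)) 1, x = 0)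
    (f : K →ₗ[A] V) : ∃ g : K →ₗ[A] W, p ∘ₗ g = f := by
  obtain ⟨y, hy⟩ := Abelian.Ext.covariant_sequence_exact₃ (ModuleCat.of A K) (kerSC_exact p hp)
    (Abelian.Ext.mk₀ (ModuleCat.ofHom f)) (n₁ := 1) rfl (h _)
  obtain ⟨g, rfl⟩ := (Abelian.Ext.mk₀_bijective _ _).2 y
  rw [Abelian.Ext.mk₀_comp_mk₀] at hy
  have := (Abelian.Ext.mk₀_bijective _ _).1 hy
  exact ⟨g.hom, congrArg ModuleCat.Hom.hom this⟩

lemma X0_of_DD [IsScalarTower A B B]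
    {K : Type u} [AddCommGroup K] [Module A K] [Module.Finite A K]
    (h : DD A B 0 K) : X0 A B K := by
  obtain ⟨m, b, hb⟩ := Module.Finite.exists_fin' A K
  let π : (Fin m → A) →ₗ[A] (Fin m → B) :=
    LinearMap.pi fun j => (LinearMap.toSpanSingleton A B 1) ∘ₗ (LinearMap.proj j)
  let Z : Submodule A (Fin m → B) := (LinearMap.ker b).map π
  have hZ : LinearMap.ker Z.mkQ = Z := Submodule.ker_mkQ Z
  have hk : LinearMap.ker b ≤ LinearMap.ker (Z.mkQ ∘ₗ π) := by
    intro x hx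
    rw [LinearMap.mem_ker, LinearMap.comp_apply, Submodule.mkQ_apply, Submodule.Quotient.mk_eq_zero]
    exact ⟨x, hx, rfl⟩
  let f : K →ₗ[A] ((Fin m → B) ⧸ Z) :=
    ((LinearMap.ker b).liftQ (Z.mkQ ∘ₗ π) hk) ∘ₗ
      (b.quotKerEquivOfSurjective hb).symm.toLinearMap
  have hf : ∀ c, f (b c) = Z.mkQ (π c) := by
    intro c
    have : (b.quotKerEquivOfSurjective hb).symm (b c) = (LinearMap.ker b).mkQ c := by
      rw [LinearEquiv.symm_apply_eq]; rfl
    simp only [f, LinearMap.comp_apply, LinearEquiv.coe_coe, this]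
    rfl
  obtain ⟨a, ha⟩ := exists_lift_of_ext Z.mkQ Z.mkQ_surjective (h m _) f
  have hq : ∀ (q : K →ₗ[A] B) (c : Fin m → A),
      q (b c) = ∑ j, π c j * q (b (Pi.single j 1)) := by
    intro q c
    exact (TD.free (B := B) m).h (q ∘ₗ b) c
  refine ⟨⟨m, fun j => b (Pi.single j 1), fun j => (LinearMap.proj j) ∘ₗ a, ?_⟩⟩
  intro q y
  obtain ⟨c, rfl⟩ := hb y
  have h1 := LinearMap.congr_fun ha (b c)
  rw [hf, LinearMap.comp_apply, ← sub_eq_zero, ← map_sub, Submodule.mkQ_apply,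
    Submodule.Quotient.mk_eq_zero] at h1
  obtain ⟨z, hz, hz'⟩ := h1
  have h2 := hq q z
  rw [hz', show b z = 0 from hz, map_zero] at h2
  rw [hq]
  simp only [Pi.sub_apply, sub_mul, Finset.sum_sub_distrib] at h2
  exact (sub_eq_zero.mp h2.symm).symm

lemma Xn_of_DD [IsScalarTower A B B] [IsNoetherianRing A] (n : ℕ) :
    ∀ (K : Type u) [AddCommGroup K] [Module A K] [Module.Finite A K], DD A B n K → Xn A B n K := by
  induction n with
  | zero => intro K _ _ _ h; exact X0_of_DD h
  | succ n ih =>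
    intro K _ _ _ h
    obtain ⟨m, b, hb⟩ := Module.Finite.exists_fin' A K
    exact ⟨m, b, hb, ih _ (DD_ker b hb h)⟩

/-- Injective dimension bound from a finite coresolution. -/
lemma injdim_of_cores (N : ℕ) : ∀ (M : Type u) [AddCommGroup M] [Module A M]
    (I : ℕ → ModuleCat.{u} A) (f : ∀ i, I i →ₗ[A] I (i + 1)) (g : M →ₗ[A] I 0),
    (∀ i, Module.Injective A (I i)) → Function.Injective g →
    LinearMap.ker (f 0) = LinearMap.range g →
    (∀ i, LinearMap.ker (f (i + 1)) = LinearMap.range (f i)) →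
    (∀ i ≥ N, Subsingleton (I i)) → HasInjectiveDimensionLT (ModuleCat.of A M) N := by
  induction N with
  | zero =>
    intro M _ _ I f g hI hg h0 h1 hN
    have := hN 0 le_rfl
    have : Subsingleton M := hg.subsingleton
    exact (ModuleCat.isZero_of_subsingleton _).hasInjectiveDimensionLT_zero
  | succ N ih =>
    intro M _ _ I f g hI hg h0 h1 hN
    have hR := ih (LinearMap.range (f 0)) (fun i => I (i + 1)) (fun i => f (i + 1))
      (LinearMap.range (f 0)).subtype (fun i => hI _) Subtype.val_injective
      (by rw [Submodule.range_subtype]; exact h1 0) (fun i => h1 (i + 1))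
      (fun i hi => hN _ (by omega))
    have hi : Injective (I 0) := by
      have := hI 0
      exact Module.injective_object_of_injective_module A (I 0)
    let S : ShortComplex (ModuleCat.{u} A) := ShortComplex.mk (ModuleCat.ofHom g)
      (ModuleCat.ofHom (Y := LinearMap.range (f 0)) (f 0).rangeRestrict) (by
        ext x
        have : g x ∈ LinearMap.ker (f 0) := by rw [h0]; exact ⟨x, rfl⟩
        exact this)
    have hS : S.ShortExact := {
      exact := by
        rw [ShortComplex.moduleCat_exact_iff]
        intro x hx
        have : x ∈ LinearMap.ker (f 0) := congrArg Subtype.val hx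
        rw [h0] at this
        exact this
      mono_f := by
        rw [ModuleCat.mono_iff_injective]
        exact hg
      epi_g := by
        rw [ModuleCat.epi_iff_surjective]
        exact (f 0).surjective_rangeRestrict }
    have h2 : HasInjectiveDimensionLT S.X₂ (N + 1) := by
      have : HasInjectiveDimensionLT S.X₂ 1 := inferInstanceAs (HasInjectiveDimensionLT (I 0) 1)
      exact hasInjectiveDimensionLT_of_ge _ 1 _ (by omega)
    exact hS.hasInjectiveDimensionLT_X₁ _ hR h2

/-- Dévissage: all finite length modules with a hereditary property have bounded
injective dimension. -/
lemma injdim_of_finiteLength (N : ℕ) (t : A)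
    (hsimple : ∀ (T : Type u) [AddCommGroup T] [Module A T] [IsSimpleModule A T],
      (∀ x : T, t • x = 0) → HasInjectiveDimensionLT (ModuleCat.of A T) N)
    (M : Type u) [AddCommGroup M] [Module A M] (hM : IsFiniteLength A M)
    (ht : ∀ x : M, t • x = 0) : HasInjectiveDimensionLT (ModuleCat.of A M) N := by
  induction hM with
  | of_subsingleton =>
    have := (ModuleCat.isZero_of_subsingleton (ModuleCat.of A ‹_›)).hasInjectiveDimensionLT_zero
    exact hasInjectiveDimensionLT_of_ge _ 0 _ (by omega)
  | @of_simple_quotient M _ _ L _ _ ih =>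
    have h1 : HasInjectiveDimensionLT (ModuleCat.of A L) N :=
      ih (fun x => Subtype.ext (ht x))
    have h2 : HasInjectiveDimensionLT (ModuleCat.of A (M ⧸ L)) N := hsimple _ (fun x => by
      obtain ⟨x, rfl⟩ := L.mkQ_surjective x
      rw [← map_smul, ht, map_zero])
    have hS := kerSC_exact L.mkQ L.mkQ_surjective
    refine hS.hasInjectiveDimensionLT_X₂ _ ?_ h2
    change HasInjectiveDimensionLT (ModuleCat.of A (LinearMap.ker L.mkQ)) N
    rw [Submodule.ker_mkQ]
    exact h1

end ExtPart

section Final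

open CategoryTheory MulOpposite

lemma mk_eq_zero_of_nilp {A B : Type u} [Ring A] [Ring B] [Module A B] [IsScalarTower A B B]
    [IsNoetherianRing A] (N : ℕ)
    (hinj : ∀ (m : ℕ) (Z : Submodule A (Fin m → B)),
      HasInjectiveDimensionLT (ModuleCat.of A Z) N)
    (a : A) (n : ℕ) (ha : a ^ n = 0) : a • (1 : B) ∈ commSub B := by
  have hD : ∀ (K : Type u) [AddCommGroup K] [Module A K], DD A B N K := by
    intro K _ _ m Z x
    have := hinj m Z
    exact Abelian.Ext.eq_zero_of_hasInjectiveDimensionLT x N (by omega)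
  have hX : ∀ (K : Type u) [AddCommGroup K] [Module A K] [Module.Finite A K], Xn A B N K :=
    fun K _ _ _ => Xn_of_DD N K (hD K)
  let φ : (Fin 1 → A) →ₗ[A] (Fin 1 → A) :=
    LinearMap.pi fun j => (LinearMap.toSpanSingleton A A a) ∘ₗ (LinearMap.proj j)
  have hφ : ∀ k y j, (φ ^ k) y j = y j * a ^ k := by
    intro k
    induction k with
    | zero => intro y j; simp
    | succ k ih =>
      intro y j
      rw [pow_succ, Module.End.mul_apply, ih, pow_succ']
      simp [φ, mul_assoc]
  have h0 : φ ^ n = 0 := by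
    refine LinearMap.ext fun y => funext fun j => ?_
    rw [hφ, ha, mul_zero]; rfl
  have := (theoryN (A := A) (B := B) N).nilp hX n _ (hX _) φ h0
  rw [TrTheory.free_tr] at this
  have h2 : (TD.free (A := A) (B := B) 1).tr φ =
      QuotientAddGroup.mk' (commSub B) (a • (1 : B)) := by
    refine (Fin.sum_univ_one (fun j : Fin 1 => QuotientAddGroup.mk' (commSub B)
      ((φ (Pi.single j 1)) j • (1 : B)))).trans ?_
    simp [φ]
  rw [h2] at this
  simpa using this

lemma isUnit_one_sub_swap {R : Type*} [Ring R] {x y : R} (h : IsUnit (1 - y * x)) :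
    IsUnit (1 - x * y) := by
  obtain ⟨z, h1, h2⟩ := isUnit_iff_exists.mp h
  refine isUnit_iff_exists.mpr ⟨1 + x * z * y, ?_, ?_⟩
  · have : (1 - x * y) * (1 + x * z * y) = 1 - x * y + x * ((1 - y * x) * z) * y := by noncomm_ring
    rw [this, h1]; noncomm_ring
  · have : (1 + x * z * y) * (1 - x * y) = 1 - x * y + x * (z * (1 - y * x)) * y := by noncomm_ring
    rw [this, h2]; noncomm_ring

lemma mem_Jset_of_mem_jacobson_op {R : Type*} [Ring R] {x : Rᵐᵒᵖ}
    (hx : x ∈ Ring.jacobson Rᵐᵒᵖ) : unop x ∈ Jset R := by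
  -- left invertibility of `1 + y x` for all `y` upgrades to invertibility
  have key : ∀ w ∈ Ring.jacobson Rᵐᵒᵖ, ∃ z : Rᵐᵒᵖ, z * (1 + w) = 1 := by
    intro w hw
    rw [← Ideal.jacobson_bot, Ideal.mem_jacobson_iff] at hw
    obtain ⟨z, hz⟩ := hw 1
    refine ⟨z, ?_⟩
    rw [Ideal.mem_bot, mul_one, sub_eq_zero] at hz
    rw [mul_add, mul_one, add_comm]; exact hz
  have unit : ∀ w ∈ Ring.jacobson Rᵐᵒᵖ, IsUnit (1 + w) := by
    intro w hw
    obtain ⟨z, hz⟩ := key w hw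
    obtain ⟨z', hz'⟩ := key (-(z * w)) (neg_mem (Ideal.mul_mem_left _ _ hw))
    have e : 1 + -(z * w) = z := by rw [← hz]; noncomm_ring
    rw [e] at hz'
    have : z' = 1 + w := by
      calc z' = z' * (z * (1 + w)) := by rw [hz, mul_one]
        _ = 1 + w := by rw [← mul_assoc, hz', one_mul]
    rw [this] at hz'
    exact isUnit_iff_exists.mpr ⟨z, hz', hz⟩
  intro y
  have := unit (-(x * op y)) (neg_mem (Ideal.mul_mem_right _ _ hx))
  have h2 := this.unop
  simpa [sub_eq_add_neg] using h2

lemma smul_eq_zero_of_mem_Jset {R : Type*} [Ring R] {T : Type*} [AddCommGroup T] [Module Rᵐᵒᵖ T]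
    [IsSimpleModule Rᵐᵒᵖ T] {x : R} (hx : x ∈ Jset R) (t : T) : op x • t = 0 := by
  by_contra h
  obtain ⟨y, hy⟩ := IsSimpleModule.toSpanSingleton_surjective Rᵐᵒᵖ h t
  rw [LinearMap.toSpanSingleton_apply, smul_smul] at hy
  have hu : IsUnit (1 - y * op x) := by
    have := (isUnit_one_sub_swap (hx (unop y))).op
    simpa using this
  have h0 : (1 - y * op x) • t = 0 := by rw [sub_smul, one_smul, hy, sub_self]
  have : t = 0 := (hu.smul_eq_zero).mp h0
  exact h (by rw [this, smul_zero])

lemma SeMod_semisimple (Λ : Type u) [Ring Λ] (e : Λ) [IsArtinianRing Λᵐᵒᵖ] :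
    IsSemisimpleModule Λᵐᵒᵖ (SeMod Λ e) := by
  have h : Module.IsTorsionBySet Λᵐᵒᵖ (SeMod Λ e) (Ring.jacobson Λᵐᵒᵖ) := by
    intro v x
    obtain ⟨x, hx⟩ := x
    obtain ⟨v, rfl⟩ := Submodule.mkQ_surjective _ v
    change x • _ = _
    rw [← map_smul, Submodule.mkQ_apply, Submodule.Quotient.mk_eq_zero]
    apply Submodule.subset_span
    change ((x • v : eSub Λ e) : Λ) ∈ Jset Λ
    have : x * op (v : Λ) ∈ Ring.jacobson Λᵐᵒᵖ := Ideal.mul_mem_right _ _ hx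
    exact mem_Jset_of_mem_jacobson_op this
  let _ := h.module
  exact h.isSemisimpleModule_iff.mp inferInstance

lemma simple_retract (Λ : Type u) [Ring Λ] (e : Λ) (he : IsIdempotentElem e)
    [IsArtinianRing Λᵐᵒᵖ] (T : Type u) [AddCommGroup T] [Module Λᵐᵒᵖ T] [IsSimpleModule Λᵐᵒᵖ T]
    (hT : ∀ x : T, op (1 - e) • x = 0) :
    ∃ (i : T →ₗ[Λᵐᵒᵖ] SeMod Λ e) (r : SeMod Λ e →ₗ[Λᵐᵒᵖ] T), r ∘ₗ i = LinearMap.id := by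
  have := SeMod_semisimple Λ e
  have : Nontrivial T := IsSimpleModule.nontrivial Λᵐᵒᵖ T
  obtain ⟨t, ht⟩ := exists_ne (0 : T)
  have het : op e • t = t := by
    have := hT t
    rw [MulOpposite.op_sub, sub_smul, MulOpposite.op_one, one_smul, sub_eq_zero] at this
    exact this.symm
  let f : eSub Λ e →ₗ[Λᵐᵒᵖ] T :=
    { toFun := fun v => op (v : Λ) • t
      map_add' := fun v w => by simp [add_smul]
      map_smul' := fun c v => by
        simp [MulOpposite.smul_eq_mul_unop, mul_smul] }
  have hf : Submodule.span Λᵐᵒᵖ {x : eSub Λ e | (x : Λ) ∈ Jset Λ} ≤ LinearMap.ker f := by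
    rw [Submodule.span_le]
    intro x hx
    exact smul_eq_zero_of_mem_Jset hx t
  let r : SeMod Λ e →ₗ[Λᵐᵒᵖ] T := Submodule.liftQ _ f hf
  have hr : Function.Surjective r := by
    rcases LinearMap.surjective_or_eq_zero r with h | h
    · exact h
    · exfalso
      apply ht
      have : r (Submodule.mkQ _ ⟨e, he⟩) = t := het
      rw [h] at this
      exact this.symm
  obtain ⟨i, hi⟩ := IsSemisimpleModule.lifting_property r hr LinearMap.id
  exact ⟨i, r, hi⟩

lemma exists_nilp_lift {R C : Type u} [Ring R] [Ring C] [IsArtinianRing R] (ρ : R →+* C)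
    (hρ : Function.Surjective ρ) (x : C) (hx : x ∈ Jset C) :
    ∃ (j : R) (n : ℕ), ρ j = x ∧ j ^ n = 0 := by
  have hxJ : x ∈ Ring.jacobson C := by
    rw [← Ideal.jacobson_bot, Ideal.mem_jacobson_iff]
    intro y
    obtain ⟨z, h1, h2⟩ := isUnit_iff_exists.mp (hx (-y))
    refine ⟨z, ?_⟩
    rw [Ideal.mem_bot, ← h2]
    noncomm_ring
  let J' : Ideal C := Ideal.map ρ (Ring.jacobson R)
  have hJ' : ∀ y, y ∈ J' ↔ ∃ j ∈ Ring.jacobson R, ρ j = y := fun y => by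
    rw [Ideal.mem_map_iff_of_surjective ρ hρ]
  have : J'.IsTwoSided := ⟨fun {a} b ha => by
    rw [hJ'] at ha ⊢
    obtain ⟨j, hj, rfl⟩ := ha
    obtain ⟨c, rfl⟩ := hρ b
    exact ⟨j * c, Ideal.mul_mem_right _ _ hj, map_mul _ _ _⟩⟩
  let q : R ⧸ Ring.jacobson R →+* C ⧸ J' := Ideal.quotientMap J' ρ Ideal.le_comap_map
  have hq : Function.Surjective q := Ideal.quotientMap_surjective hρ
  have : IsSemisimpleRing (C ⧸ J') := RingHom.isSemisimpleRing_of_surjective q hq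
  have h1 := Ring.jacobson_le_of_eq_bot (IsSemisimpleRing.jacobson_eq_bot (C ⧸ J')) hxJ
  obtain ⟨j, hj, hjx⟩ := (hJ' x).mp h1
  obtain ⟨n, hn⟩ := IsSemiprimaryRing.isNilpotent (R := R)
  refine ⟨j, n, hjx, ?_⟩
  have := Ideal.pow_mem_pow hj n
  rw [hn] at this
  simpa using this

end Final

/-- Theorem 1.5: if Λ is an artin algebra and e an idempotent such that S_e = eΛ/eJ has
finite injective dimension, then HH₀(Λ_e) is radical-trivial: the Jacobson radical of
Λ_e = Λ/Λ(1-e)Λ is contained in the commutator subgroup [Λ_e, Λ_e]. -/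
theorem HH0_corner_radical_trivial (k : Type u) [CommRing k] [IsArtinianRing k]
    (Λ : Type u) [Ring Λ] [Algebra k Λ] [Module.Finite k Λ]
    (e : Λ) (he : IsIdempotentElem e)
    (hfin : FinInjDim Λ (SeMod Λ e)) :
    ∀ x : corner Λ e, x ∈ Jset (corner Λ e) → x ∈ commSub (corner Λ e) := by
  intro x hx
  have hA1 : IsArtinianRing Λ := IsArtinianRing.of_finite k Λ
  have hfinop : Module.Finite k Λᵐᵒᵖ :=
    Module.Finite.equiv (MulOpposite.opLinearEquiv k : Λ ≃ₗ[k] Λᵐᵒᵖ)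
  have hA2 : IsArtinianRing Λᵐᵒᵖ := IsArtinianRing.of_finite k Λᵐᵒᵖ
  have hA3 : IsNoetherianRing Λᵐᵒᵖ := inferInstance
  have hρs : Function.Surjective (cornerProj Λ e) := RingCon.mk'_surjective _
  let ρ : Λᵐᵒᵖ →+* (corner Λ e)ᵐᵒᵖ := RingHom.op (cornerProj Λ e)
  letI instM : Module Λᵐᵒᵖ (corner Λ e)ᵐᵒᵖ := Module.compHom _ ρ
  have hsm : ∀ (a : Λᵐᵒᵖ) (b : (corner Λ e)ᵐᵒᵖ), a • b = ρ a * b := fun _ _ => rfl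
  haveI : IsScalarTower Λᵐᵒᵖ (corner Λ e)ᵐᵒᵖ (corner Λ e)ᵐᵒᵖ :=
    ⟨fun a b c => by rw [hsm, smul_eq_mul, hsm, smul_eq_mul, mul_assoc]⟩
  have hone : ∀ a : Λᵐᵒᵖ, a • (1 : (corner Λ e)ᵐᵒᵖ) = ρ a := fun a => by rw [hsm, mul_one]
  haveI : Module.Finite Λᵐᵒᵖ (corner Λ e)ᵐᵒᵖ := by
    refine Module.Finite.of_surjective
      (LinearMap.toSpanSingleton Λᵐᵒᵖ (corner Λ e)ᵐᵒᵖ 1) ?_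
    intro b
    obtain ⟨a, ha⟩ := hρs (MulOpposite.unop b)
    refine ⟨MulOpposite.op a, ?_⟩
    rw [LinearMap.toSpanSingleton_apply, hone]
    exact congrArg MulOpposite.op ha
  obtain ⟨I, f, g, hI, hg, h0, h1, N, hN⟩ := hfin
  have hS := injdim_of_cores N (SeMod Λ e) I f g hI hg h0 h1 hN
  have hsimple : ∀ (T : Type u) [AddCommGroup T] [Module Λᵐᵒᵖ T] [IsSimpleModule Λᵐᵒᵖ T],
      (∀ x : T, MulOpposite.op (1 - e) • x = 0) →
      CategoryTheory.HasInjectiveDimensionLT (ModuleCat.of Λᵐᵒᵖ T) N := by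
    intro T _ _ _ hT
    obtain ⟨i, r, hir⟩ := simple_retract Λ e he T hT
    let R : CategoryTheory.Retract (ModuleCat.of Λᵐᵒᵖ T) (ModuleCat.of Λᵐᵒᵖ (SeMod Λ e)) :=
      { i := ModuleCat.ofHom i
        r := ModuleCat.ofHom r
        retract := by rw [← ModuleCat.ofHom_comp, hir]; rfl }
    exact R.hasInjectiveDimensionLT N
  have hz : ρ (MulOpposite.op (1 - e)) = 0 := by
    have : cornerProj Λ e (1 - e) = 0 := by
      have hm : (1 - e) ∈ TwoSidedIdeal.span {1 - e} := TwoSidedIdeal.subset_span rfl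
      exact (RingCon.eq _).mpr hm
    exact congrArg MulOpposite.op this
  have hinj : ∀ (m : ℕ) (Z : Submodule Λᵐᵒᵖ (Fin m → (corner Λ e)ᵐᵒᵖ)),
      CategoryTheory.HasInjectiveDimensionLT (ModuleCat.of Λᵐᵒᵖ Z) N := by
    intro m Z
    refine injdim_of_finiteLength N (MulOpposite.op (1 - e)) hsimple Z
      (isFiniteLength_iff_isNoetherian_isArtinian.mpr ⟨inferInstance, inferInstance⟩) ?_
    intro z
    refine Subtype.ext (funext fun j => ?_)
    change MulOpposite.op (1 - e) • (z.1 j) = 0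
    rw [hsm, hz, zero_mul]
  obtain ⟨j, n, hj, hjn⟩ := exists_nilp_lift (cornerProj Λ e) hρs x hx
  have hc := mk_eq_zero_of_nilp (B := (corner Λ e)ᵐᵒᵖ) N hinj (MulOpposite.op j) n
    (by rw [← MulOpposite.op_pow, hjn, MulOpposite.op_zero])
  rw [hone] at hc
  have hρj : ρ (MulOpposite.op j) = MulOpposite.op x := congrArg MulOpposite.op hj
  rw [hρj] at hc
  have hle : commSub (corner Λ e)ᵐᵒᵖ ≤ (commSub (corner Λ e)).comap
      (MulOpposite.opAddEquiv (α := corner Λ e)).symm.toAddMonoidHom := by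
    unfold commSub
    rw [AddSubgroup.closure_le]
    rintro _ ⟨a, b, rfl⟩
    exact AddSubgroup.subset_closure ⟨MulOpposite.unop b, MulOpposite.unop a, rfl⟩
  exact hle hc
end

section
/- If Λ is an artin algebra of finite global dimension, then the Jacobson radical of Λ is contained in the commutator subgroup [Λ,Λ]; that is, HH₀(Λ) = Λ/[Λ,Λ] is radical-trivial. -/
universe u

section HS

variable {R : Type u} [Ring R]

/-- The class in `R/[R,R]`. -/
def hcl (R : Type u) [Ring R] : R →+ R ⧸ commSub R := QuotientAddGroup.mk' (commSub R)

theorem hcl_comm (a b : R) : hcl R (a * b) = hcl R (b * a) := by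
  refine (QuotientAddGroup.eq_iff_sub_mem).2 ?_
  exact AddSubgroup.subset_closure ⟨a, b, rfl⟩

/-- Hattori-Stallings trace for free modules. -/
def freeTr {n : ℕ} (φ : (Fin n → R) →ₗ[R] (Fin n → R)) : R ⧸ commSub R :=
  ∑ i, hcl R (φ (Pi.single i 1) i)

theorem freeTr_comm {m n : ℕ} (α : (Fin m → R) →ₗ[R] (Fin n → R))
    (β : (Fin n → R) →ₗ[R] (Fin m → R)) : freeTr (α ∘ₗ β) = freeTr (β ∘ₗ α) := by
  have key : ∀ {m n : ℕ} (α : (Fin m → R) →ₗ[R] (Fin n → R))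
      (β : (Fin n → R) →ₗ[R] (Fin m → R)), freeTr (α ∘ₗ β) =
      ∑ i, ∑ j, hcl R (β (Pi.single i 1) j * α (Pi.single j 1) i) := by
    intro m n α β
    unfold freeTr
    refine Finset.sum_congr rfl fun i _ => ?_
    rw [LinearMap.comp_apply, LinearMap.pi_apply_eq_sum_univ α, Finset.sum_apply, map_sum]
    refine Finset.sum_congr rfl fun j _ => ?_
    have e : (fun i => if j = i then (1 : R) else 0) = Pi.single j 1 := by
      ext l; simp [Pi.single_apply, eq_comm]
    rw [e, Pi.smul_apply, smul_eq_mul]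
  rw [key, key, Finset.sum_comm]
  exact Finset.sum_congr rfl fun i _ => Finset.sum_congr rfl fun j _ => hcl_comm _ _

theorem exists_frame (M : Type u) [AddCommGroup M] [Module R M] [Module.Finite R M]
    [Module.Projective R M] : ∃ (n : ℕ) (p : (Fin n → R) →ₗ[R] M) (s : M →ₗ[R] (Fin n → R)),
      p ∘ₗ s = LinearMap.id := by
  obtain ⟨n, p, s, _, _, h⟩ := Module.Finite.exists_comp_eq_id_of_projective R M
  exact ⟨n, p, s, h⟩

section
variable {M N K P : Type u} [AddCommGroup M] [Module R M] [Module.Finite R M]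
    [Module.Projective R M] [AddCommGroup N] [Module R N] [Module.Finite R N]
    [Module.Projective R N] [AddCommGroup K] [Module R K] [Module.Finite R K]
    [Module.Projective R K] [AddCommGroup P] [Module R P] [Module.Finite R P]
    [Module.Projective R P]

/-- Hattori-Stallings trace for finitely generated projective modules. -/
noncomputable def hsTr (f : M →ₗ[R] M) : R ⧸ commSub R :=
  freeTr ((exists_frame (R := R) M).choose_spec.choose_spec.choose ∘ₗ f ∘ₗ
    (exists_frame (R := R) M).choose_spec.choose)

theorem hsTr_eq (M : Type u) [AddCommGroup M] [Module R M] [Module.Finite R M]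
    [Module.Projective R M] : ∃ (n : ℕ) (p : (Fin n → R) →ₗ[R] M) (s : M →ₗ[R] (Fin n → R)),
      p ∘ₗ s = LinearMap.id ∧ ∀ f : M →ₗ[R] M, hsTr f = freeTr (s ∘ₗ f ∘ₗ p) :=
  ⟨_, _, _, (exists_frame (R := R) M).choose_spec.choose_spec.choose_spec, fun _ => rfl⟩

theorem hsTr_comm (a : M →ₗ[R] N) (b : N →ₗ[R] M) : hsTr (a ∘ₗ b) = hsTr (b ∘ₗ a) := by
  obtain ⟨m, p, s, h, hM⟩ := hsTr_eq (R := R) M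
  obtain ⟨n, q, t, h', hN⟩ := hsTr_eq (R := R) N
  rw [hM, hN]
  have e1 : t ∘ₗ (a ∘ₗ b) ∘ₗ q = (t ∘ₗ a ∘ₗ p) ∘ₗ (s ∘ₗ b ∘ₗ q) := by
    ext1 i; ext1; 
    have := fun x => LinearMap.congr_fun h x
    simp at this
    simp [this]
  have e2 : s ∘ₗ (b ∘ₗ a) ∘ₗ p = (s ∘ₗ b ∘ₗ q) ∘ₗ (t ∘ₗ a ∘ₗ p) := by
    ext1 i; ext1; 
    have := fun x => LinearMap.congr_fun h' x
    simp at this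
    simp [this]
  rw [e1, e2, freeTr_comm]

theorem hsTr_add (f g : M →ₗ[R] M) : hsTr (f + g) = hsTr f + hsTr g := by
  obtain ⟨m, p, s, h, hM⟩ := hsTr_eq (R := R) M
  simp [hM, freeTr, Finset.sum_add_distrib]

theorem hsTr_zero_of_subsingleton [Subsingleton M] (f : M →ₗ[R] M) : hsTr f = 0 := by
  have h := hsTr_add f f
  have : f + f = f := Subsingleton.elim _ _
  rw [this] at h
  simpa using h

theorem hsTr_ses (i : K →ₗ[R] P) (π : P →ₗ[R] M) (hi : Function.Injective i)
    (hπ : Function.Surjective π) (hex : LinearMap.ker π = LinearMap.range i)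
    (F : P →ₗ[R] P) (f : M →ₗ[R] M) (G : K →ₗ[R] K) (hF : π ∘ₗ F = f ∘ₗ π)
    (hG : F ∘ₗ i = i ∘ₗ G) : hsTr F = hsTr f + hsTr G := by
  obtain ⟨σ, hσ⟩ := Module.projective_lifting_property π (LinearMap.id) hπ
  have hσ' : ∀ x, π (σ x) = x := fun x => LinearMap.congr_fun hσ x
  have hmem : ∀ x, x - σ (π x) ∈ LinearMap.range i := fun x => by
    rw [← hex]; simp [hσ']
  let e := LinearEquiv.ofInjective i hi
  let r : P →ₗ[R] K := e.symm.toLinearMap ∘ₗ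
    (LinearMap.codRestrict (LinearMap.range i) (LinearMap.id - σ ∘ₗ π) hmem)
  have hr : ∀ x, i (r x) = x - σ (π x) := fun x => by
    have := congrArg Subtype.val (e.apply_symm_apply ⟨x - σ (π x), hmem x⟩)
    exact this
  have hri : ∀ k, r (i k) = k := fun k => hi (by
    rw [hr]
    have : π (i k) = 0 := by
      have : i k ∈ LinearMap.ker π := hex ▸ ⟨k, rfl⟩
      exact this
    simp [this])
  have hF1 : F = (F ∘ₗ σ) ∘ₗ π + (F ∘ₗ i) ∘ₗ r := by
    ext x
    simp [hr]
  rw [hF1, hsTr_add, hsTr_comm, hsTr_comm (F ∘ₗ i) r]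
  congr 2
  · ext x
    have := LinearMap.congr_fun hF (σ x)
    simpa [hσ'] using this
  · rw [hG]; ext x; simp [hri]

end

theorem hsTr_self (f : R →ₗ[R] R) : hsTr f = hcl R (f 1) := by
  obtain ⟨m, p, s, h, hM⟩ := hsTr_eq (R := R) R
  rw [hM]
  have h1 : p (s 1) = 1 := LinearMap.congr_fun h 1
  rw [LinearMap.pi_apply_eq_sum_univ p] at h1
  have h2 : ∀ (i : Fin m), s (f (p (Pi.single i 1))) i = p (Pi.single i 1) * (f 1 * s 1 i) := by
    intro i
    have e1 : ∀ x, f x = x * f 1 := fun x => by simpa using f.map_smul x 1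
    have e2 : ∀ x, s x = x • s 1 := fun x => by simpa using s.map_smul x 1
    rw [e1, e2]; simp [mul_assoc]
  simp only [freeTr, LinearMap.comp_apply, h2]
  simp_rw [hcl_comm (p _)]
  rw [← map_sum]
  have h3 := congrArg (fun z => f 1 * z) h1
  simp only [Finset.mul_sum, mul_one] at h3
  refine Eq.trans ?_ (congrArg (hcl R) h3)
  congr 1
  refine Finset.sum_congr rfl fun i _ => ?_
  have e : (fun j => if i = j then (1 : R) else 0) = Pi.single i 1 := by
    ext l; simp [Pi.single_apply, eq_comm]
  rw [mul_assoc, smul_eq_mul, e]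

/-- Chains of modules witnessing nilpotency of an endomorphism. -/
inductive NilChain (C : ModuleCat.{u} R → Prop) :
    (M : ModuleCat.{u} R) → (M →ₗ[R] M) → Prop
  | zero (M : ModuleCat.{u} R) (f : M →ₗ[R] M) (hM : C M) (hs : Subsingleton M) : NilChain C M f
  | step (M N : ModuleCat.{u} R) (h : N →ₗ[R] N) (a : N →ₗ[R] M) (g : M →ₗ[R] N)
      (hM : C M) (hN : NilChain C N h) (hh : g ∘ₗ a = h) : NilChain C M (a ∘ₗ g)

theorem NilChain.base {C : ModuleCat.{u} R → Prop} {M : ModuleCat.{u} R} {f : M →ₗ[R] M}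
    (h : NilChain C M f) : C M := by
  cases h <;> assumption

theorem NilChain.mono {C D : ModuleCat.{u} R → Prop} (hCD : ∀ M, C M → D M)
    {M : ModuleCat.{u} R} {f : M →ₗ[R] M} (h : NilChain C M f) : NilChain D M f := by
  induction h with
  | zero M f hM hs => exact .zero M f (hCD _ hM) hs
  | step M N h a g hM hN hh ih => exact .step M N h a g (hCD _ hM) ih hh

/-- finitely generated projective -/
def FGP (M : ModuleCat.{u} R) : Prop := Module.Finite R M ∧ Module.Projective R M

/-- finitely generated of projective dimension at most `n` -/
def FPD (n : ℕ) (M : ModuleCat.{u} R) : Prop :=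
  Module.Finite R M ∧ CategoryTheory.HasProjectiveDimensionLT M (n + 1)

theorem NilChain.tr_zero {M : ModuleCat.{u} R} {f : M →ₗ[R] M} (h : NilChain FGP M f) :
    ∀ [Module.Finite R M] [Module.Projective R M], hsTr f = 0 := by
  induction h with
  | zero M f hM hs => intro _ _; exact hsTr_zero_of_subsingleton f
  | step M N h a g hM hN hh ih =>
    intro _ _
    have := hN.base.1
    have := hN.base.2
    rw [hsTr_comm, hh, ih]

theorem FPD.ker [IsNoetherianRing R] {n : ℕ} {M P : ModuleCat.{u} R} (hM : FPD (n + 1) M)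
    (hP : FGP P) (π : P →ₗ[R] M) (hπ : Function.Surjective π) :
    FPD n (ModuleCat.of R (LinearMap.ker π)) := by
  have := hP.1
  have := hP.2
  refine ⟨inferInstanceAs (Module.Finite R (LinearMap.ker π)), ?_⟩
  have hS := LinearMap.shortExact_shortComplexKer hπ
  refine (hS.hasProjectiveDimensionLT_X₃_iff n ?_).1 hM.2
  exact (IsProjective.iff_projective (R := R) P).1 hP.2

theorem NilChain.cover [IsNoetherianRing R] {n : ℕ} {M : ModuleCat.{u} R} {f : M →ₗ[R] M}
    (h : NilChain (FPD (n + 1)) M f) :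
    ∃ (P : ModuleCat.{u} R) (π : P →ₗ[R] M) (F : P →ₗ[R] P)
      (G : LinearMap.ker π →ₗ[R] LinearMap.ker π),
      Function.Surjective π ∧ π ∘ₗ F = f ∘ₗ π ∧
      F ∘ₗ (LinearMap.ker π).subtype = (LinearMap.ker π).subtype ∘ₗ G ∧
      NilChain FGP P F ∧ NilChain (FPD n) (ModuleCat.of R (LinearMap.ker π)) G := by
  induction h with
  | zero M f hM hs =>
    have hP : FGP (ModuleCat.of R PUnit.{u+1}) :=
      ⟨inferInstanceAs (Module.Finite R PUnit.{u+1}),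
        inferInstanceAs (Module.Projective R PUnit.{u+1})⟩
    have hsur : Function.Surjective (0 : ModuleCat.of R PUnit.{u+1} →ₗ[R] M) :=
      fun x => ⟨0, Subsingleton.elim _ _⟩
    refine ⟨ModuleCat.of R PUnit.{u+1}, 0, 0, 0, hsur, ?_, ?_, ?_, ?_⟩
    · exact LinearMap.ext fun _ => Subsingleton.elim _ _
    · exact LinearMap.ext fun _ => rfl
    · exact .zero _ _ hP (inferInstanceAs (Subsingleton PUnit.{u+1}))
    · refine .zero _ _ (hM.ker hP 0 hsur) ?_
      exact ⟨fun x y => Subtype.ext rfl⟩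
  | step M N h a g hM hN hh ih =>
    obtain ⟨P', π', H, G', hs', hc', hG', hn', hk'⟩ := ih
    have := hM.1
    have := hn'.base.1
    have := hn'.base.2
    obtain ⟨m, q, hq⟩ := Module.Finite.exists_fin' R M
    obtain ⟨l, hl⟩ := Module.projective_lifting_property π' (g ∘ₗ q) hs'
    let P := ModuleCat.of R ((Fin m → R) × P')
    have hP : FGP P := ⟨inferInstanceAs (Module.Finite R ((Fin m → R) × P')),
        inferInstanceAs (Module.Projective R ((Fin m → R) × P'))⟩
    let π : P →ₗ[R] M := LinearMap.coprod q (a ∘ₗ π')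
    let gt : P →ₗ[R] P' := LinearMap.coprod l H
    let at' : P' →ₗ[R] P := LinearMap.inr R (Fin m → R) P'
    have hgt : gt ∘ₗ at' = H := LinearMap.coprod_inr _ _
    have hπ : Function.Surjective π := fun x => by
      obtain ⟨y, rfl⟩ := hq x
      exact ⟨(y, 0), (LinearMap.coprod_apply q (a ∘ₗ π') (y, 0)).trans (by simp)⟩
    have hπa : π ∘ₗ at' = a ∘ₗ π' := LinearMap.coprod_inr _ _
    have hπg : π' ∘ₗ gt = g ∘ₗ π := by
      refine LinearMap.prod_ext ?_ ?_
      · rw [LinearMap.comp_assoc, LinearMap.comp_assoc]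
        erw [LinearMap.coprod_inl, LinearMap.coprod_inl]
        exact hl
      · rw [LinearMap.comp_assoc, LinearMap.comp_assoc]
        erw [LinearMap.coprod_inr, LinearMap.coprod_inr]
        rw [hc', ← hh]; rfl
    have hga : ∀ x, g (a x) = h x := fun x => LinearMap.congr_fun hh x
    have hπg' : ∀ x, π' (gt x) = g (π x) := fun x => LinearMap.congr_fun hπg x
    have hπa' : ∀ x, π (at' x) = a (π' x) := fun x => LinearMap.congr_fun hπa x
    have hgt' : ∀ x, gt (at' x) = H x := fun x => LinearMap.congr_fun hgt x
    let gk : LinearMap.ker π →ₗ[R] LinearMap.ker π' := gt.restrict (fun x hx => by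
      rw [LinearMap.mem_ker] at hx ⊢; rw [hπg', hx, map_zero])
    let ak : LinearMap.ker π' →ₗ[R] LinearMap.ker π := at'.restrict (fun x hx => by
      rw [LinearMap.mem_ker] at hx ⊢; rw [hπa', hx, map_zero])
    refine ⟨P, π, at' ∘ₗ gt, ak ∘ₗ gk, hπ, ?_, ?_, ?_, ?_⟩
    · refine LinearMap.ext fun x => ?_
      simp only [LinearMap.comp_apply, hπa', hπg']
    · rfl
    · exact .step _ _ _ _ _ hP hn' hgt
    · refine .step (ModuleCat.of R (LinearMap.ker π)) (ModuleCat.of R (LinearMap.ker π'))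
        G' ak gk (hM.ker hP π hπ) hk' ?_
      refine LinearMap.ext fun x => Subtype.ext ?_
      exact (hgt' x).trans (LinearMap.congr_fun hG' x)

theorem NilChain.tr_zero' [IsNoetherianRing R] (n : ℕ) : ∀ {M : ModuleCat.{u} R}
    {f : M →ₗ[R] M} (_ : NilChain (FPD n) M f) [Module.Finite R M] [Module.Projective R M],
    hsTr f = 0 := by
  induction n with
  | zero =>
    intro M f h _ _
    refine (h.mono (D := FGP) fun M hM => ⟨hM.1, ?_⟩).tr_zero
    exact (IsProjective.iff_projective (R := R) M).2
      (CategoryTheory.projective_iff_hasProjectiveDimensionLT_one.2 hM.2)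
  | succ n ih =>
    intro M f h _ _
    obtain ⟨P, π, F, G, hs, hc, hG, hn, hk⟩ := h.cover
    have := hn.base.1
    have := hn.base.2
    have : Module.Projective R (LinearMap.ker π) := by
      obtain ⟨σ, hσ⟩ := Module.projective_lifting_property π (LinearMap.id) hs
      have hσ' : ∀ x, π (σ x) = x := fun x => LinearMap.congr_fun hσ x
      refine Module.Projective.of_split (LinearMap.ker π).subtype
        (LinearMap.codRestrict (LinearMap.ker π) (LinearMap.id - σ ∘ₗ π)
          (fun x => by simp [hσ'])) ?_
      ext x
      have : π x = 0 := x.2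
      simp [this]
    have e := hsTr_ses (LinearMap.ker π).subtype π (Submodule.subtype_injective _) hs
      (by simp) F f G hc hG
    have e1 := hn.tr_zero
    have e2 := @ih (ModuleCat.of R (LinearMap.ker π)) G hk
      (inferInstanceAs (Module.Finite R (LinearMap.ker π))) this
    rw [e1] at e
    erw [e2] at e
    simpa using e.symm

theorem exists_chain (hfd : ∀ M : ModuleCat.{u} R, Module.Finite R M → ∃ n, FPD n M) (m : ℕ) :
    ∀ (M : ModuleCat.{u} R) (f : M →ₗ[R] M), Module.Finite R M → f ^ m = 0 →
      ∃ n, NilChain (FPD n) M f := by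
  induction m with
  | zero =>
    intro M f hM hf
    obtain ⟨n, hn⟩ := hfd M hM
    refine ⟨n, .zero _ _ hn ⟨fun x y => ?_⟩⟩
    have h : ∀ x, x = (0 : M) := fun x => by simpa using LinearMap.congr_fun hf x
    rw [h x, h y]
  | succ m ih =>
    intro M f hM hf
    let fr : LinearMap.range f →ₗ[R] LinearMap.range f :=
      f.restrict (fun x _ => LinearMap.mem_range_self f x)
    have hfr : ∀ (j : ℕ) (x : LinearMap.range f), ((fr ^ j) x : M) = (f ^ j) x := by
      intro j
      induction j with
      | zero => intro x; simp
      | succ j ihj => intro x; rw [pow_succ, pow_succ, Module.End.mul_apply, ihj]; rfl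
    have h0 : fr ^ m = 0 := by
      refine LinearMap.ext fun x => Subtype.ext ?_
      rw [hfr]
      obtain ⟨y, hy⟩ := x.2
      rw [← hy, ← Module.End.mul_apply, ← pow_succ, hf]; rfl
    obtain ⟨n, hn⟩ := ih (ModuleCat.of R (LinearMap.range f)) fr
      (inferInstanceAs (Module.Finite R (LinearMap.range f))) h0
    obtain ⟨n', hn'⟩ := hfd M hM
    have mon : ∀ {a b : ℕ}, a ≤ b → ∀ M : ModuleCat.{u} R, FPD a M → FPD b M := by
      intro a b hab M hM
      have := hM.2
      exact ⟨hM.1, CategoryTheory.hasProjectiveDimensionLT_of_ge M (a + 1) (b + 1) (by omega)⟩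
    exact ⟨max n n', .step M (ModuleCat.of R (LinearMap.range f)) fr
      (LinearMap.range f).subtype f.rangeRestrict (mon (le_max_right _ _) _ hn')
      (hn.mono (mon (le_max_left _ _))) rfl⟩

theorem nilpotent_mem [IsNoetherianRing R]
    (hfd : ∀ M : ModuleCat.{u} R, Module.Finite R M → ∃ n, FPD n M) (x : R)
    (hx : IsNilpotent x) : x ∈ commSub R := by
  obtain ⟨m, hm⟩ := hx
  let f : R →ₗ[R] R := LinearMap.toSpanSingleton R R x
  have hf : ∀ j y, (f ^ j) y = y * x ^ j := by
    intro j
    induction j with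
    | zero => intro y; simp
    | succ j ih => intro y; rw [pow_succ, Module.End.mul_apply, ih, pow_succ']; simp [f, mul_assoc]
  obtain ⟨n, hn⟩ := exists_chain hfd m (ModuleCat.of R R) f
    (inferInstanceAs (Module.Finite R R)) (by
      refine LinearMap.ext fun y => ?_
      exact (hf m y).trans (by rw [hm, mul_zero]; rfl))
  have h := @NilChain.tr_zero' R _ _ n _ _ hn (inferInstanceAs (Module.Finite R R))
    (inferInstanceAs (Module.Projective R R))
  have h2 := (hsTr_self f).symm.trans h
  have h3 : hcl R x = 0 := by simpa [f] using h2
  exact (QuotientAddGroup.eq_zero_iff x).1 h3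

end HS

theorem pd_of_res {R : Type u} [Ring R] (N : ℕ) : ∀ (M : ModuleCat.{u} R)
    (P : ℕ → ModuleCat.{u} R) (f : ∀ i, P (i+1) →ₗ[R] P i) (g : P 0 →ₗ[R] M)
    (_ : ∀ i, Module.Projective R (P i)) (_ : Function.Surjective g)
    (_ : LinearMap.ker g = LinearMap.range (f 0))
    (_ : ∀ i, LinearMap.ker (f i) = LinearMap.range (f (i+1)))
    (_ : ∀ i ≥ N, Subsingleton (P i)), CategoryTheory.HasProjectiveDimensionLT M N := by
  induction N with
  | zero =>
    intro M P f g hP hg h0 h1 hN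
    have := hN 0 le_rfl
    have : Subsingleton M := hg.subsingleton
    exact (ModuleCat.isZero_of_subsingleton M).hasProjectiveDimensionLT_zero
  | succ N ih =>
    intro M P f g hP hg h0 h1 hN
    have hS := LinearMap.shortExact_shortComplexKer hg
    have hmem : ∀ x, f 0 x ∈ LinearMap.ker g := fun x => h0 ▸ LinearMap.mem_range_self _ x
    have hK := ih (ModuleCat.of R (LinearMap.ker g)) (fun i => P (i + 1)) (fun i => f (i + 1))
      (LinearMap.codRestrict (LinearMap.ker g) (f 0) hmem) (fun i => hP _)
      (fun y => by
        have : (y.1 : P 0) ∈ LinearMap.range (f 0) := h0.le y.2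
        obtain ⟨x, hx⟩ := this
        exact ⟨x, Subtype.ext hx⟩)
      (by rw [← h1 0]; exact LinearMap.ker_codRestrict _ _ _) (fun i => h1 _)
      (fun i hi => hN _ (by omega))
    have hp : CategoryTheory.Projective (P 0) :=
      (IsProjective.iff_projective (R := R) (P 0)).1 (hP 0)
    have hp' : CategoryTheory.HasProjectiveDimensionLT (P 0) (N + 1) :=
      CategoryTheory.hasProjectiveDimensionLT_of_ge _ 1 _ (by omega)
    exact hS.hasProjectiveDimensionLT_X₃ N hK hp'

theorem Jset_nilpotent (k : Type u) [CommRing k] [IsArtinianRing k]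
    (Λ : Type u) [Ring Λ] [Algebra k Λ] [Module.Finite k Λ] (x : Λ) (hx : x ∈ Jset Λ) :
    IsNilpotent x := by
  have : IsArtinian k Λ := inferInstance
  obtain ⟨n, hn⟩ := IsArtinian.monotone_stabilizes
    (LinearMap.iterateRange (LinearMap.mulRight k x))
  have h := hn (n + 1) (Nat.le_succ n)
  have hp : ∀ (j : ℕ) (z : Λ), (LinearMap.mulRight k x ^ j) z = z * x ^ j := by
    intro j z
    rw [LinearMap.pow_mulRight, LinearMap.mulRight_apply]
  have hm : x ^ n ∈ LinearMap.range (LinearMap.mulRight k x ^ n) := ⟨1, by rw [hp, one_mul]⟩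
  have hm' : x ^ n ∈ LinearMap.range (LinearMap.mulRight k x ^ (n + 1)) := h.ge hm
  obtain ⟨y, hy⟩ := hm'
  rw [hp, pow_succ', ← mul_assoc] at hy
  refine ⟨n, (hx y).mul_right_eq_zero.1 ?_⟩
  rw [sub_mul, one_mul, hy, sub_self]

theorem op_comm {Λ : Type u} [Ring Λ] (z : Λᵐᵒᵖ) (hz : z ∈ commSub Λᵐᵒᵖ) :
    z.unop ∈ commSub Λ := by
  induction hz using AddSubgroup.closure_induction with
  | mem z hz =>
    obtain ⟨a, b, rfl⟩ := hz
    exact AddSubgroup.subset_closure ⟨b.unop, a.unop, by simp⟩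
  | zero => exact zero_mem _
  | add x y _ _ hx hy => exact add_mem hx hy
  | neg x _ hx => exact neg_mem hx

/-- Corollary 1.6 (Lenzing): if Λ is an artin algebra of finite global dimension (every
finitely generated right Λ-module has finite projective dimension), then HH₀(Λ) is
radical-trivial: the Jacobson radical of Λ is contained in [Λ,Λ]. -/
theorem HH0_radical_trivial_of_finGlobalDim (k : Type u) [CommRing k] [IsArtinianRing k]
    (Λ : Type u) [Ring Λ] [Algebra k Λ] [Module.Finite k Λ]
    (hgl : ∀ (M : ModuleCat.{u} Λᵐᵒᵖ), Module.Finite Λᵐᵒᵖ M → FinProjDim Λ M) :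
    ∀ x : Λ, x ∈ Jset Λ → x ∈ commSub Λ := by
  intro x hx
  have hnil := Jset_nilpotent k Λ x hx
  have hfin : Module.Finite k Λᵐᵒᵖ := Module.Finite.equiv (MulOpposite.opLinearEquiv k)
  have : IsNoetherianRing Λᵐᵒᵖ := isNoetherian_of_tower k inferInstance
  refine op_comm (MulOpposite.op x) (nilpotent_mem ?_ _ ?_)
  · intro M hM
    obtain ⟨P, f, g, hP, hg, h0, h1, N, hN⟩ := hgl M hM
    have := pd_of_res N M P f g hP hg h0 h1 hN
    exact ⟨N, hM, CategoryTheory.hasProjectiveDimensionLT_of_ge M N (N + 1) (by omega)⟩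
  · obtain ⟨m, hm⟩ := hnil
    exact ⟨m, by rw [← MulOpposite.op_pow, hm]; rfl⟩
end

section
/- Let Λ be an artin algebra with radical J and e a basic primitive idempotent of Λ such that the algebra (e+J²)(Λ/J²)(e+J²) is commutative. If the simple module S_e = eΛ/eJ has finite injective dimension, then eJe ⊆ eJ²e; in particular Ext¹_Λ(S_e, S_e) = 0. -/
universe u

section CoreHelpers

variable {A : Type*} [Ring A]

theorem snl_factor_inj {S X M : Type*} [AddCommGroup S] [Module A S] [AddCommGroup X] [Module A X]
    [AddCommGroup M] [Module A M] (α : S →ₗ[A] X) (hα : Function.Injective α) (f : M →ₗ[A] X)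
    (h : ∀ m, ∃ s, α s = f m) : ∃ g : M →ₗ[A] S, ∀ m, α (g m) = f m := by
  choose g hg using h
  refine ⟨{ toFun := g, map_add' := ?_, map_smul' := ?_ }, hg⟩
  · intro x y; apply hα; simp [hg]
  · intro x y; apply hα; simp [hg]

theorem snl_factor_surj {P X M : Type*} [AddCommGroup P] [Module A P] [AddCommGroup X] [Module A X]
    [AddCommGroup M] [Module A M] (π : P →ₗ[A] M) (hπ : Function.Surjective π) (f : P →ₗ[A] X)
    (h : ∀ p, π p = 0 → f p = 0) : ∃ g : M →ₗ[A] X, ∀ p, g (π p) = f p := by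
  have key : ∀ p q, π p = π q → f p = f q := by
    intro p q hpq
    have := h (p - q) (by simp [hpq])
    rwa [map_sub, sub_eq_zero] at this
  choose σ hσ using hπ
  refine ⟨{ toFun := fun m => f (σ m), map_add' := ?_, map_smul' := ?_ }, ?_⟩
  · intro x y; rw [← map_add]; apply key; simp [hσ]
  · intro x y; rw [← map_smul]; apply key; simp [hσ]
  · intro p; apply key; simp [hσ]

theorem snl_trace_add {R F' F F'' : Type*} [CommRing R] [AddCommGroup F'] [Module R F']
    [AddCommGroup F] [Module R F] [AddCommGroup F''] [Module R F'']
    [Module.Free R F'] [Module.Finite R F'] [Module.Free R F] [Module.Finite R F]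
    [Module.Free R F''] [Module.Finite R F'']
    (i : F' →ₗ[R] F) (q : F →ₗ[R] F'') (hi : Function.Injective i) (hq : Function.Surjective q)
    (hex : ∀ p, q p = 0 ↔ ∃ k, i k = p)
    (a' : F' →ₗ[R] F') (a : F →ₗ[R] F) (a'' : F'' →ₗ[R] F'')
    (h1 : ∀ x, a (i x) = i (a' x)) (h2 : ∀ x, q (a x) = a'' (q x)) :
    LinearMap.trace R F a = LinearMap.trace R F' a' + LinearMap.trace R F'' a'' := by
  obtain ⟨σ, hσ⟩ := Module.projective_lifting_property q LinearMap.id hq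
  have hσ' : ∀ x, q (σ x) = x := fun x => LinearMap.congr_fun hσ x
  obtain ⟨r, hr⟩ := snl_factor_inj i hi (LinearMap.id - σ ∘ₗ q) (by
    intro m
    apply (hex _).1
    simp [hσ'])
  have hri : ∀ x, r (i x) = x := by
    intro x
    apply hi
    rw [hr]
    have : q (i x) = 0 := (hex _).2 ⟨x, rfl⟩
    simp [this]
  have e : a = i ∘ₗ (r ∘ₗ a) + σ ∘ₗ (q ∘ₗ a) := by
    ext x
    simp [hr]
  have e1 : (r ∘ₗ a) ∘ₗ i = a' := by ext x; simp [h1, hri]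
  have e2 : (q ∘ₗ a) ∘ₗ σ = a'' := by ext x; simp [h2, hσ']
  rw [e, map_add, LinearMap.trace_comp_comm', e1, LinearMap.trace_comp_comm', e2]

end CoreHelpers

section Core

variable {A : Type u} [Ring A] {I : ℕ → Type u} [∀ i, AddCommGroup (I i)] [∀ i, Module A (I i)]

/-- Vanishing of the cohomology of `Hom(M, I)` in degree `i+1`. -/
def snlV (f : ∀ i, I i →ₗ[A] I (i+1)) (i : ℕ) (M : Type u) [AddCommGroup M] [Module A M] : Prop :=
  ∀ h : M →ₗ[A] I (i+1), (∀ m, f (i+1) (h m) = 0) → ∃ h' : M →ₗ[A] I i, ∀ m, f i (h' m) = h m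

variable (f : ∀ i, I i →ₗ[A] I (i+1)) (hI : ∀ i, Module.Injective A (I i))
  (hf : ∀ i x, f (i+1) x = 0 ↔ ∃ y, f i y = x)

include hf in
theorem snlV_proj (i : ℕ) (P : Type u) [AddCommGroup P] [Module A P] [Module.Projective A P] :
    snlV f i P := by
  intro h hh
  obtain ⟨g, hg⟩ := snl_factor_inj (LinearMap.range (f i)).subtype Subtype.val_injective h (by
    intro m
    obtain ⟨y, hy⟩ := (hf i _).1 (hh m)
    exact ⟨⟨h m, y, hy⟩, rfl⟩)
  obtain ⟨h', hh'⟩ := Module.projective_lifting_property (f i).rangeRestrict g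
    (f i).surjective_rangeRestrict
  refine ⟨h', fun m => ?_⟩
  rw [← hg, ← hh']
  rfl

variable {K P M : Type u} [AddCommGroup K] [Module A K] [AddCommGroup P] [Module A P]
  [AddCommGroup M] [Module A M] (ι : K →ₗ[A] P) (π : P →ₗ[A] M)
  (hι : Function.Injective ι) (hπ : Function.Surjective π) (hex : ∀ p, π p = 0 ↔ ∃ k, ι k = p)

include hI hf hι hπ hex in
theorem snlV_ker (i : ℕ) (hP : snlV f i P) (hM : snlV f (i+1) M) : snlV f i K := by
  intro h hh
  obtain ⟨H, hH⟩ := (hI (i+1)).out ι hι h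
  obtain ⟨u, hu⟩ := snl_factor_surj π hπ (f (i+1) ∘ₗ H) (by
    intro p hp
    obtain ⟨k, rfl⟩ := (hex p).1 hp
    simp [hH, hh])
  obtain ⟨g, hg⟩ := hM u (by
    intro m
    obtain ⟨p, rfl⟩ := hπ m
    rw [hu]
    exact (hf _ _).2 ⟨_, rfl⟩)
  obtain ⟨h', hh'⟩ := hP (H - g ∘ₗ π) (by
    intro p
    simp [hg, hu])
  refine ⟨h' ∘ₗ ι, fun k => ?_⟩
  have : π (ι k) = 0 := (hex _).2 ⟨k, rfl⟩
  simp [hh', this, hH]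

include hI hf hι hπ hex in
theorem snlV_mid (i : ℕ) (hK : snlV f i K) (hM : snlV f i M) : snlV f i P := by
  intro h hh
  obtain ⟨a, ha⟩ := hK (h ∘ₗ ι) (by intro m; simp [hh])
  obtain ⟨b, hb⟩ := (hI i).out ι hι a
  obtain ⟨c, hc⟩ := snl_factor_surj π hπ (h - f i ∘ₗ b) (by
    intro p hp
    obtain ⟨k, rfl⟩ := (hex p).1 hp
    simp [hb, ha])
  obtain ⟨d, hd⟩ := hM c (by
    intro m
    obtain ⟨p, rfl⟩ := hπ m
    rw [hc]
    have : f (i+1) (f i (b p)) = 0 := (hf _ _).2 ⟨_, rfl⟩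
    simp [hh, this])
  refine ⟨b + d ∘ₗ π, fun p => ?_⟩
  simp [hd, hc]

variable {S : Type u} [AddCommGroup S] [Module A S] (g : S →ₗ[A] I 0) (hg : Function.Injective g)
  (hfg : ∀ x, f 0 x = 0 ↔ ∃ y, g y = x)

include hI hf hι hπ hex hg hfg in
/-- Maps `K → S` extend to `P` when `Ext¹(M,S) = 0`. -/
theorem snl_extend (hM : snlV f 0 M) (h : K →ₗ[A] S) : ∃ H : P →ₗ[A] S, ∀ k, H (ι k) = h k := by
  obtain ⟨H, hH⟩ := (hI 0).out ι hι (g ∘ₗ h)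
  obtain ⟨u, hu⟩ := snl_factor_surj π hπ (f 0 ∘ₗ H) (by
    intro p hp
    obtain ⟨k, rfl⟩ := (hex p).1 hp
    simp only [LinearMap.comp_apply, hH]
    exact (hfg _).2 ⟨_, rfl⟩)
  obtain ⟨v, hv⟩ := hM u (by
    intro m
    obtain ⟨p, rfl⟩ := hπ m
    rw [hu]
    exact (hf _ _).2 ⟨_, rfl⟩)
  obtain ⟨w, hw⟩ := snl_factor_inj g hg (H - v ∘ₗ π) (by
    intro p
    apply (hfg _).1
    simp [hv, hu])
  refine ⟨w, fun k => ?_⟩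
  have : π (ι k) = 0 := (hex _).2 ⟨k, rfl⟩
  apply hg
  simp [hw, this, hH]

include hI hf hg hfg in
/-- Maps `N → Y` lift through `X → Y` with kernel `S` when `Ext¹(N,S) = 0`. -/
theorem snl_lift {X Y N : Type u} [AddCommGroup X] [Module A X] [AddCommGroup Y] [Module A Y]
    [AddCommGroup N] [Module A N] (α : S →ₗ[A] X) (β : X →ₗ[A] Y)
    (hα : Function.Injective α) (hβ : Function.Surjective β) (hαβ : ∀ p, β p = 0 ↔ ∃ k, α k = p)
    (hN : snlV f 0 N) (h : N →ₗ[A] Y) : ∃ H : N →ₗ[A] X, ∀ k, β (H k) = h k := by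
  obtain ⟨G, hG⟩ := (hI 0).out α hα g
  obtain ⟨u, hu⟩ := snl_factor_surj β hβ (f 0 ∘ₗ G) (by
    intro p hp
    obtain ⟨k, rfl⟩ := (hαβ p).1 hp
    simp only [LinearMap.comp_apply, hG]
    exact (hfg _).2 ⟨_, rfl⟩)
  obtain ⟨v, hv⟩ := hN (u ∘ₗ h) (by
    intro m
    obtain ⟨p, hp⟩ := hβ (h m)
    rw [LinearMap.comp_apply, ← hp, hu]
    exact (hf _ _).2 ⟨_, rfl⟩)
  obtain ⟨w, hw⟩ := snl_factor_inj (β.prod G) (by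
    rw [injective_iff_map_eq_zero]
    intro x hx
    replace hx : β x = 0 ∧ G x = 0 := Prod.mk_eq_zero.1 hx
    obtain ⟨k, rfl⟩ := (hαβ x).1 hx.1
    rw [hG] at hx
    have : k = 0 := hg (by simp [hx.2])
    simp [this]) (h.prod v) (by
    intro m
    obtain ⟨p, hp⟩ := hβ (h m)
    have h1 : f 0 (G p - v m) = 0 := by
      have := hu p
      rw [hp] at this
      simp [hv, this]
    obtain ⟨s, hs⟩ := (hfg _).1 h1
    refine ⟨p - α s, ?_⟩
    have : β (α s) = 0 := (hαβ _).2 ⟨s, rfl⟩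
    ext
    · simp [hp, this]
    · simp [hG, hs])
  exact ⟨w, fun k => congrArg Prod.fst (hw k)⟩

end Core
section Core2

theorem snl_free {R T : Type*} [CommRing R] [IsLocalRing R] [IsNoetherianRing R] (t : R)
    (ht : ∀ r : R, ¬ IsUnit r → ∃ s, r = t * s) (htu : ¬ IsUnit t) (htt : t * t = 0)
    [AddCommGroup T] [Module R T] [Module.Finite R T]
    (h : ∀ x : T, t • x = 0 → ∃ y, x = t • y) : Module.Free R T := by
  have : Module.FinitePresentation R T := Module.finitePresentation_of_finite R T
  apply Module.free_of_maximalIdeal_rTensor_injective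
  rw [injective_iff_map_eq_zero]
  have key : ∀ z : TensorProduct R (IsLocalRing.maximalIdeal R) T,
      ∃ x : T, z = TensorProduct.tmul R ⟨t, htu⟩ x := by
    intro z
    induction z using TensorProduct.induction_on with
    | zero => exact ⟨0, by simp⟩
    | tmul a x =>
      obtain ⟨a, ha⟩ := a
      obtain ⟨s, rfl⟩ := ht a ha
      refine ⟨s • x, ?_⟩
      rw [← TensorProduct.smul_tmul]
      congr 1
      ext
      simp [mul_comm]
    | add a b ha hb =>
      obtain ⟨x, rfl⟩ := ha
      obtain ⟨y, rfl⟩ := hb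
      exact ⟨x + y, by rw [TensorProduct.tmul_add]⟩
  intro z hz
  obtain ⟨x, rfl⟩ := key z
  have hx : t • x = 0 := by
    have := congrArg (TensorProduct.lid R T) hz
    simpa using this
  obtain ⟨y, rfl⟩ := h x hx
  rw [← TensorProduct.smul_tmul]
  have : t • (⟨t, htu⟩ : IsLocalRing.maximalIdeal R) = 0 := by
    ext
    simpa using htt
  rw [this, TensorProduct.zero_tmul]

variable {A : Type u} [Ring A] [IsNoetherianRing A]
  {I : ℕ → Type u} [∀ i, AddCommGroup (I i)] [∀ i, Module A (I i)]
  (f : ∀ i, I i →ₗ[A] I (i+1)) (hI : ∀ i, Module.Injective A (I i))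
  (hf : ∀ i x, f (i+1) x = 0 ↔ ∃ y, f i y = x)
  {S : Type u} [AddCommGroup S] [Module A S] (g : S →ₗ[A] I 0) (hg : Function.Injective g)
  (hfg : ∀ x, f 0 x = 0 ↔ ∃ y, g y = x)
  {R : Type u} [CommRing R] [IsLocalRing R] [IsNoetherianRing R] [Module A R] [SMulCommClass A R R]
  (t : R) (ht : ∀ r : R, ¬ IsUnit r → ∃ s, r = t * s) (htu : ¬ IsUnit t) (htt : t * t = 0)
  (α : S →ₗ[A] R) (β : R →ₗ[A] S) (hα : Function.Injective α) (hβ : Function.Surjective β)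
  (hαβ : ∀ p, β p = 0 ↔ ∃ k, α k = p) (hab : ∀ r, α (β r) = t * r)

/-- Precomposition on `Hom(M,R)`. -/
def snlPre (R : Type u) [CommRing R] [Module A R] [SMulCommClass A R R]
    {M N : Type u} [AddCommGroup M] [Module A M] [AddCommGroup N] [Module A N]
    (φ : M →ₗ[A] N) : (N →ₗ[A] R) →ₗ[R] (M →ₗ[A] R) where
  toFun h := h ∘ₗ φ
  map_add' _ _ := rfl
  map_smul' _ _ := rfl

omit [IsNoetherianRing A] [IsLocalRing R] in
theorem snl_hom_finite (M : Type u) [AddCommGroup M] [Module A M] [Module.Finite A M] :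
    Module.Finite R (M →ₗ[A] R) := by
  obtain ⟨n, s, hs⟩ := Module.Finite.exists_fin (R := A) (M := M)
  let F : (M →ₗ[A] R) →ₗ[R] (Fin n → R) :=
    { toFun := fun h i => h (s i), map_add' := fun _ _ => rfl, map_smul' := fun _ _ => rfl }
  refine Module.Finite.of_injective F ?_
  intro a b hab
  refine LinearMap.ext_on_range hs ?_
  intro i
  exact congrFun hab i

include hI hf hg hfg ht htu htt hα hβ hαβ hab in
theorem snl_hom_free (M : Type u) [AddCommGroup M] [Module A M] [Module.Finite A M]
    (hM : snlV f 0 M) : Module.Free R (M →ₗ[A] R) := by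
  have := snl_hom_finite (A := A) (R := R) M
  refine snl_free t ht htu htt ?_
  intro x hx
  have hx' : ∀ m, t * x m = 0 := fun m => LinearMap.congr_fun hx m
  obtain ⟨y, hy⟩ := snl_factor_inj α hα x (by
    intro m
    apply (hαβ _).1
    apply hα
    rw [hab, hx', map_zero])
  obtain ⟨z, hz⟩ := snl_lift f hI hf g hg hfg α β hα hβ hαβ hM y
  refine ⟨z, ?_⟩
  ext m
  rw [← hy, ← hz, hab]
  rfl

/-- The trace of an endomorphism acting on `Hom(M,R)`. -/
noncomputable def snlTr (R : Type u) [CommRing R] [Module A R] [SMulCommClass A R R]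
    {M : Type u} [AddCommGroup M] [Module A M] (φ : M →ₗ[A] M) : R :=
  LinearMap.trace R (M →ₗ[A] R) (snlPre R φ)

section ses

variable {K P M : Type u} [AddCommGroup K] [Module A K] [AddCommGroup P] [Module A P]
  [AddCommGroup M] [Module A M] [Module.Finite A K] [Module.Finite A P] [Module.Finite A M]
  (ι : K →ₗ[A] P) (π : P →ₗ[A] M)
  (hι : Function.Injective ι) (hπ : Function.Surjective π) (hex : ∀ p, π p = 0 ↔ ∃ k, ι k = p)

include hI hf hι hπ hex hg hfg ht htu htt hα hβ hαβ hab in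
theorem snlTr_add (hK : snlV f 0 K) (hP : snlV f 0 P) (hM : snlV f 0 M)
    (κ : K →ₗ[A] K) (ψ : P →ₗ[A] P) (φ : M →ₗ[A] M)
    (h1 : ∀ x, ψ (ι x) = ι (κ x)) (h2 : ∀ x, π (ψ x) = φ (π x)) :
    snlTr R ψ = snlTr R κ + snlTr R φ := by
  have := snl_hom_finite (A := A) (R := R) M
  have := snl_hom_finite (A := A) (R := R) P
  have := snl_hom_finite (A := A) (R := R) K
  have := snl_hom_free f hI hf g hg hfg t ht htu htt α β hα hβ hαβ hab M hM
  have := snl_hom_free f hI hf g hg hfg t ht htu htt α β hα hβ hαβ hab P hP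
  have := snl_hom_free f hI hf g hg hfg t ht htu htt α β hα hβ hαβ hab K hK
  rw [add_comm]
  refine snl_trace_add (snlPre R π) (snlPre R ι) ?_ ?_ ?_ _ _ _ ?_ ?_
  · intro a b hab
    ext m
    obtain ⟨p, rfl⟩ := hπ m
    exact LinearMap.congr_fun hab p
  · intro h
    obtain ⟨H1, hH1⟩ := snl_extend f hI hf ι π hι hπ hex g hg hfg hM (β ∘ₗ h)
    obtain ⟨H2, hH2⟩ := snl_lift f hI hf g hg hfg α β hα hβ hαβ hP H1
    obtain ⟨h2, hh2⟩ := snl_factor_inj α hα (h - H2 ∘ₗ ι) (by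
      intro k
      apply (hαβ _).1
      simp [hH2, hH1])
    obtain ⟨H3, hH3⟩ := snl_extend f hI hf ι π hι hπ hex g hg hfg hM h2
    refine ⟨H2 + α ∘ₗ H3, ?_⟩
    ext k
    simp [snlPre, hH3, hh2]
  · intro h
    constructor
    · intro h0
      obtain ⟨k, hk⟩ := snl_factor_surj π hπ h (by
        intro p hp
        obtain ⟨k, rfl⟩ := (hex p).1 hp
        exact LinearMap.congr_fun h0 k)
      exact ⟨k, by ext p; exact hk p⟩
    · rintro ⟨k, rfl⟩
      ext p
      have : π (ι p) = 0 := (hex _).2 ⟨p, rfl⟩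
      simp [snlPre, this]
  · intro h
    ext p
    simp [snlPre, h2]
  · intro h
    ext p
    simp [snlPre, h1]

end ses

/-- `r` is a possible value of the derived trace of `φ`, computed with a resolution of length `d`. -/
def snlRel (R : Type u) [CommRing R] [Module A R] [SMulCommClass A R R] : ℕ →
    ∀ (M : Type u) [AddCommGroup M] [Module A M], (M →ₗ[A] M) → R → Prop
  | 0, M, _, _, φ, r => (∀ i, snlV f i M) ∧ snlTr R φ = r
  | d+1, M, _, _, φ, r => ∃ (P : Type u) (_ : AddCommGroup P) (_ : Module A P)
      (_ : Module.Finite A P) (_ : Module.Projective A P)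
      (π : P →ₗ[A] M) (ψ : P →ₗ[A] P) (κ : LinearMap.ker π →ₗ[A] LinearMap.ker π) (s : R),
      Function.Surjective π ∧ (∀ x, π (ψ x) = φ (π x)) ∧ (∀ x, ψ x.1 = (κ x).1) ∧
      snlRel R d (LinearMap.ker π) κ s ∧ r = snlTr R ψ - s

theorem snlTr_zero (R : Type u) [CommRing R] [Module A R] [SMulCommClass A R R]
    {M : Type u} [AddCommGroup M] [Module A M] : snlTr R (0 : M →ₗ[A] M) = 0 := by
  have : snlPre R (0 : M →ₗ[A] M) = 0 := by
    ext h m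
    simp [snlPre]
  rw [snlTr, this, map_zero]

include hI hf in
theorem snlRel_zero (d : ℕ) : ∀ (M : Type u) [AddCommGroup M] [Module A M] [Module.Finite A M],
    (∀ i, d ≤ i → snlV f i M) → snlRel f R d M 0 0 := by
  induction d with
  | zero =>
    intro M _ _ _ h
    exact ⟨fun i => h i (Nat.zero_le _), snlTr_zero R⟩
  | succ d ih =>
    intro M _ _ _ h
    obtain ⟨n, π, hπ⟩ := Module.Finite.exists_fin' A M
    refine ⟨Fin n → A, inferInstance, inferInstance, inferInstance, inferInstance, π, 0, 0, 0,
      hπ, by simp, by simp, ih _ ?_, by simp [snlTr_zero]⟩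
    intro i hi
    exact snlV_ker f hI hf (LinearMap.ker π).subtype π Subtype.val_injective hπ (by simp) i
      (snlV_proj f hf i _) (h _ (by omega))

include hI hf hg hfg ht htu htt hα hβ hαβ hab in
theorem snlRel_unique (d : ℕ) : ∀ (M : Type u) [AddCommGroup M] [Module A M] [Module.Finite A M]
    (φ : M →ₗ[A] M) (r : R), (∀ i, snlV f i M) → snlRel f R d M φ r → r = snlTr R φ := by
  induction d with
  | zero =>
    intro M _ _ _ φ r _ h
    exact h.2.symm
  | succ d ih =>
    intro M _ _ _ φ r hM h
    obtain ⟨P, _, _, _, _, π, ψ, κ, s, hπ, h1, h2, h3, rfl⟩ := h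
    have hK : ∀ i, snlV f i (LinearMap.ker π) := fun i =>
      snlV_ker f hI hf (LinearMap.ker π).subtype π Subtype.val_injective hπ (by simp) i
        (snlV_proj f hf i _) (hM _)
    have e := ih _ _ _ hK h3
    rw [e, snlTr_add f hI hf g hg hfg t ht htu htt α β hα hβ hαβ hab (LinearMap.ker π).subtype π
      Subtype.val_injective hπ (by simp) (hK 0) (snlV_proj f hf 0 _) (hM 0) κ ψ φ h2 h1]
    ring

include hI hf hg hfg ht htu htt hα hβ hαβ hab in
theorem snlRel_add (d : ℕ) : ∀ (M' M M'' : Type u) [AddCommGroup M'] [Module A M']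
    [AddCommGroup M] [Module A M] [AddCommGroup M''] [Module A M'']
    [Module.Finite A M'] [Module.Finite A M] [Module.Finite A M'']
    (ι : M' →ₗ[A] M) (q : M →ₗ[A] M'') (_ : Function.Injective ι) (_ : Function.Surjective q)
    (_ : ∀ p, q p = 0 ↔ ∃ k, ι k = p)
    (φ' : M' →ₗ[A] M') (φ : M →ₗ[A] M) (φ'' : M'' →ₗ[A] M'')
    (_ : ∀ x, φ (ι x) = ι (φ' x)) (_ : ∀ x, q (φ x) = φ'' (q x)) (r' r'' : R)
    (_ : snlRel f R d M' φ' r') (_ : snlRel f R d M'' φ'' r''), snlRel f R d M φ (r' + r'') := by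
  induction d with
  | zero =>
    intro M' M M'' _ _ _ _ _ _ _ _ _ ι q hι hq hex φ' φ φ'' h1 h2 r' r'' h' h''
    have hM : ∀ i, snlV f i M := fun i => snlV_mid f hI hf ι q hι hq hex i (h'.1 i) (h''.1 i)
    refine ⟨hM, ?_⟩
    rw [← h'.2, ← h''.2]
    exact snlTr_add f hI hf g hg hfg t ht htu htt α β hα hβ hαβ hab ι q hι hq hex
      (h'.1 0) (hM 0) (h''.1 0) _ _ _ h1 h2
  | succ d ih =>
    intro M' M M'' _ _ _ _ _ _ _ _ _ ι q hι hq hex φ' φ φ'' h1 h2 r' r'' h' h''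
    obtain ⟨P', _, _, _, _, π', ψ', κ', s', hπ', ha', hb', hc', rfl⟩ := h'
    obtain ⟨P'', _, _, _, _, π'', ψ'', κ'', s'', hπ'', ha'', hb'', hc'', rfl⟩ := h''
    obtain ⟨σ, hσ⟩ := Module.projective_lifting_property q π'' hq
    replace hσ : ∀ x, q (σ x) = π'' x := fun x => LinearMap.congr_fun hσ x
    obtain ⟨w, hw⟩ := snl_factor_inj ι hι (φ ∘ₗ σ - σ ∘ₗ ψ'') (by
      intro m
      apply (hex _).1
      simp [h2, hσ, ha''])
    obtain ⟨v, hv⟩ := Module.projective_lifting_property π' w hπ'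
    replace hv : ∀ x, π' (v x) = w x := fun x => LinearMap.congr_fun hv x
    have hqι : ∀ x, q (ι x) = 0 := fun x => (hex _).2 ⟨x, rfl⟩
    let π : (P' × P'') →ₗ[A] M := (ι ∘ₗ π').coprod σ
    have hπd : ∀ x, π x = ι (π' x.1) + σ x.2 := fun x => rfl
    let ψ : (P' × P'') →ₗ[A] (P' × P'') :=
      ((ψ' ∘ₗ LinearMap.fst A P' P'') + v ∘ₗ LinearMap.snd A P' P'').prod
        (ψ'' ∘ₗ LinearMap.snd A P' P'')
    have hψd : ∀ x, ψ x = (ψ' x.1 + v x.2, ψ'' x.2) := fun x => rfl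
    have hπψ : ∀ x, π (ψ x) = φ (π x) := by
      intro x
      rw [hπd, hψd, hπd]
      simp only [map_add, ha', hv, hw, h1, LinearMap.sub_apply, LinearMap.comp_apply]
      abel
    have hπs : Function.Surjective π := by
      intro m
      obtain ⟨y, hy⟩ := hπ'' (q m)
      obtain ⟨z, hz⟩ := (hex (m - σ y)).1 (by simp [hσ, hy])
      obtain ⟨x, rfl⟩ := hπ' z
      refine ⟨(x, y), ?_⟩
      simp [hπd, hz]
    have hmem : ∀ x : LinearMap.ker π, ψ x.1 ∈ LinearMap.ker π := by
      intro x
      rw [LinearMap.mem_ker, hπψ, LinearMap.mem_ker.1 x.2, map_zero]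
    let κ : LinearMap.ker π →ₗ[A] LinearMap.ker π :=
      LinearMap.codRestrict _ (ψ ∘ₗ (LinearMap.ker π).subtype) hmem
    have hi : ∀ x : LinearMap.ker π', LinearMap.inl A P' P'' x.1 ∈ LinearMap.ker π := by
      intro x
      simp [hπd, LinearMap.mem_ker.1 x.2]
    have hp : ∀ x : LinearMap.ker π, (x.1).2 ∈ LinearMap.ker π'' := by
      intro x
      have := congrArg q (LinearMap.mem_ker.1 x.2)
      rw [hπd] at this
      simpa [hqι, hσ] using this
    let i : LinearMap.ker π' →ₗ[A] LinearMap.ker π :=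
      LinearMap.codRestrict _ (LinearMap.inl A P' P'' ∘ₗ (LinearMap.ker π').subtype) hi
    let p : LinearMap.ker π →ₗ[A] LinearMap.ker π'' :=
      LinearMap.codRestrict _ (LinearMap.snd A P' P'' ∘ₗ (LinearMap.ker π).subtype) hp
    refine ⟨P' × P'', inferInstance, inferInstance, inferInstance, inferInstance, π, ψ, κ, s' + s'',
      hπs, hπψ, fun _ => rfl, ?_, ?_⟩
    · refine ih _ _ _ i p ?_ ?_ ?_ κ' κ κ'' ?_ ?_ s' s'' hc' hc''
      · intro a b hab
        have := congrArg (fun z : LinearMap.ker π => z.1.1) hab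
        exact Subtype.ext this
      · rintro ⟨y, hy⟩
        have hy0 : π'' y = 0 := hy
        obtain ⟨z, hz⟩ := (hex (σ y)).1 (by rw [hσ, hy0])
        obtain ⟨x, rfl⟩ := hπ' z
        refine ⟨⟨(-x, y), ?_⟩, rfl⟩
        simp [hπd, hz]
      · rintro ⟨⟨x, y⟩, hxy⟩
        constructor
        · intro h0
          have hy : y = 0 := congrArg Subtype.val h0
          subst hy
          rw [LinearMap.mem_ker, hπd] at hxy
          refine ⟨⟨x, ?_⟩, rfl⟩
          apply hι
          simpa using hxy
        · rintro ⟨k, hk⟩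
          rw [← hk]
          rfl
      · intro x
        apply Subtype.ext
        change ψ (x.1, 0) = ((κ' x).1, 0)
        rw [hψd]
        simp [hb']
      · intro x
        apply Subtype.ext
        exact hb'' (p x)
    · have := snlTr_add f hI hf g hg hfg t ht htu htt α β hα hβ hαβ hab (LinearMap.inl A P' P'')
        (LinearMap.snd A P' P'') LinearMap.inl_injective LinearMap.snd_surjective
        (by rintro ⟨a, b⟩; simp [eq_comm]) (snlV_proj f hf 0 _) (snlV_proj f hf 0 _)
        (snlV_proj f hf 0 _) ψ' ψ ψ'' (by intro x; simp [hψd]) (by intro x; simp [hψd])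
      rw [this]
      ring

include hI hf hg hfg ht htu htt hα hβ hαβ hab in
theorem snlRel_nil (d : ℕ) (hd : ∀ i, d ≤ i → ∀ (M : Type u) [AddCommGroup M] [Module A M],
      snlV f i M) (n : ℕ) :
    ∀ (M : Type u) [AddCommGroup M] [Module A M] [Module.Finite A M] (φ : M →ₗ[A] M),
      φ ^ n = 0 → snlRel f R d M φ 0 := by
  induction n with
  | zero =>
    intro M _ _ _ φ h
    have : φ = 0 := by
      rw [pow_zero] at h
      rw [← one_mul φ, h, zero_mul]
    rw [this]
    exact snlRel_zero f hI hf d M (fun i hi => hd i hi M)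
  | succ n ih =>
    intro M _ _ _ φ h
    let ρ : LinearMap.range φ →ₗ[A] LinearMap.range φ :=
      LinearMap.codRestrict _ (φ ∘ₗ (LinearMap.range φ).subtype) (fun x => ⟨_, rfl⟩)
    have hρ : ∀ (m : ℕ) x, ((ρ ^ m) x).1 = (φ ^ m) x.1 := by
      intro m
      induction m with
      | zero => intro x; rfl
      | succ m ihm =>
        intro x
        rw [pow_succ, pow_succ, Module.End.mul_apply, Module.End.mul_apply, ihm]
        rfl
    have h1 := ih (LinearMap.range φ) ρ (by
      ext x
      obtain ⟨x, y, rfl⟩ := x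
      rw [hρ]
      have := LinearMap.congr_fun h y
      rw [pow_succ] at this
      exact this)
    have h2 := snlRel_zero (R := R) f hI hf d (M ⧸ LinearMap.range φ) (fun i hi => hd i hi _)
    have := snlRel_add f hI hf g hg hfg t ht htu htt α β hα hβ hαβ hab d _ M _
      (LinearMap.range φ).subtype (LinearMap.range φ).mkQ Subtype.val_injective
      (Submodule.mkQ_surjective _) (by simp) ρ φ 0 (fun _ => rfl) (by intro x; simp) 0 0 h1 h2
    simpa using this

include hI hf hg hfg ht htu htt hα hβ hαβ hab in
/-- Nilpotent endomorphisms of projective modules have trace zero. -/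
theorem snl_nil_trace (d : ℕ) (hd : ∀ i, d ≤ i → Subsingleton (I i))
    (M : Type u) [AddCommGroup M] [Module A M] [Module.Finite A M] [Module.Projective A M]
    (φ : M →ₗ[A] M) (n : ℕ) (hn : φ ^ n = 0) : snlTr R φ = 0 := by
  have h := snlRel_nil f hI hf g hg hfg t ht htu htt α β hα hβ hαβ hab d (by
    intro i hi M _ _ h _
    have := hd (i+1) (by omega)
    exact ⟨0, fun m => Subsingleton.elim _ _⟩) n M φ hn
  exact (snlRel_unique f hI hf g hg hfg t ht htu htt α β hα hβ hαβ hab d M φ 0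
    (fun i => snlV_proj f hf i M) h).symm

end Core2
section RingPart

theorem snl_isUnit_swap {L : Type*} [Ring L] (x y : L) (h : IsUnit (1 - x * y)) :
    IsUnit (1 - y * x) := by
  obtain ⟨u, hu⟩ := h
  have h1 : (1 - x * y) * (↑u⁻¹ : L) = 1 := by rw [← hu]; simp
  have h2 : (↑u⁻¹ : L) * (1 - x * y) = 1 := by rw [← hu]; simp
  generalize (↑u⁻¹ : L) = w at h1 h2
  refine isUnit_iff_exists.2 ⟨1 + y * w * x, ?_, ?_⟩
  · have : (1 - y * x) * (1 + y * w * x) = 1 - y * x + y * ((1 - x * y) * w) * x := by noncomm_ring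
    rw [this, h1]; noncomm_ring
  · have : (1 + y * w * x) * (1 - y * x) = 1 - y * x + y * (w * (1 - x * y)) * x := by noncomm_ring
    rw [this, h2]; noncomm_ring

variable {L : Type u} [Ring L]

theorem snlJ_left {a : L} (ha : a ∈ Jset L) (y : L) : y * a ∈ Jset L := by
  intro z
  rw [← mul_assoc]
  exact ha _

theorem snlJ_right {a : L} (ha : a ∈ Jset L) (y : L) : a * y ∈ Jset L := by
  intro z
  rw [← mul_assoc]
  apply snl_isUnit_swap
  rw [← mul_assoc]
  exact ha _

theorem snlJ_add {a b : L} (ha : a ∈ Jset L) (hb : b ∈ Jset L) : a + b ∈ Jset L := by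
  intro y
  obtain ⟨u, hu⟩ := ha y
  have : 1 - y * (a + b) = u * (1 - (↑u⁻¹ * y) * b) := by
    rw [mul_sub, mul_assoc, Units.mul_inv_cancel_left, hu]
    noncomm_ring
  rw [this]
  exact u.isUnit.mul (hb _)

theorem snlJ_zero : (0 : L) ∈ Jset L := by intro y; simp

theorem snl_nil_mem {a : L} (h : ∀ y, IsNilpotent (y * a)) : a ∈ Jset L :=
  fun y => (h y).isUnit_one_sub

theorem snl_nil_swap {a y : L} (h : IsNilpotent (a * y)) : IsNilpotent (y * a) := by
  obtain ⟨n, hn⟩ := h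
  refine ⟨n + 1, ?_⟩
  have : ∀ n, (y * a) ^ (n + 1) = y * (a * y) ^ n * a := by
    intro n
    induction n with
    | zero => simp
    | succ n ih => rw [pow_succ, ih, pow_succ]; simp only [mul_assoc]
  rw [this, hn]; simp

/-- Strong pi-regularity. -/
theorem snl_pi_regular (k : Type u) [CommRing k] [IsArtinianRing k] [Algebra k L]
    [Module.Finite k L] (a : L) : ∃ n b c, a ^ (n + 1) = a ^ (n + 1) * a ^ (n + 1) * b ∧
      a ^ (n + 1) = c * (a ^ (n + 1) * a ^ (n + 1)) := by
  obtain ⟨n1, h1⟩ := IsArtinian.monotone_stabilizes (R := k) (M := L)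
    ⟨fun n => OrderDual.toDual (LinearMap.range (LinearMap.mulLeft k (a ^ n))), by
      apply monotone_nat_of_le_succ
      intro n
      rw [OrderDual.toDual_le_toDual]
      rintro _ ⟨y, rfl⟩
      exact ⟨a * y, by simp [pow_succ]⟩⟩
  obtain ⟨n2, h2⟩ := IsArtinian.monotone_stabilizes (R := k) (M := L)
    ⟨fun n => OrderDual.toDual (LinearMap.range (LinearMap.mulRight k (a ^ n))), by
      apply monotone_nat_of_le_succ
      intro n
      rw [OrderDual.toDual_le_toDual]
      rintro _ ⟨y, rfl⟩
      exact ⟨y * a, by simp [pow_succ', mul_assoc]⟩⟩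
  have e1 : ∀ m, n1 ≤ m → LinearMap.range (LinearMap.mulLeft k (a ^ n1)) =
    LinearMap.range (LinearMap.mulLeft k (a ^ m)) := fun m hm => h1 m hm
  have e2 : ∀ m, n2 ≤ m → LinearMap.range (LinearMap.mulRight k (a ^ n2)) =
    LinearMap.range (LinearMap.mulRight k (a ^ m)) := fun m hm => h2 m hm
  have f1 : a ^ (n1 + n2 + 1) ∈
      LinearMap.range (LinearMap.mulLeft k (a ^ ((n1 + n2 + 1) + (n1 + n2 + 1)))) := by
    rw [← e1 _ (by omega), e1 (n1 + n2 + 1) (by omega)]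
    exact ⟨1, by simp⟩
  have f2 : a ^ (n1 + n2 + 1) ∈
      LinearMap.range (LinearMap.mulRight k (a ^ ((n1 + n2 + 1) + (n1 + n2 + 1)))) := by
    rw [← e2 _ (by omega), e2 (n1 + n2 + 1) (by omega)]
    exact ⟨1, by simp⟩
  obtain ⟨b, hb⟩ := f1
  obtain ⟨c, hc⟩ := f2
  refine ⟨n1 + n2, b, c, ?_, ?_⟩
  · rw [← pow_add]; exact hb.symm
  · rw [← pow_add]; exact hc.symm

theorem snl_dich (k : Type u) [CommRing k] [IsArtinianRing k] [Algebra k L]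
    [Module.Finite k L] {e : L} (he : IsPrimitiveIdem e) (a : L) (h1 : e * a = a) (h2 : a * e = a) :
    IsNilpotent a ∨ ∃ w, a * w = e ∧ w * a = e := by
  obtain ⟨n, b, c, hb, hc⟩ := snl_pi_regular k a
  obtain ⟨_, hee, hprim⟩ := he
  have hee' : e * e = e := hee
  have hp1 : e * a ^ (n + 1) = a ^ (n + 1) := by rw [pow_succ', ← mul_assoc, h1]
  have hp2 : a ^ (n + 1) * e = a ^ (n + 1) := by rw [pow_succ, mul_assoc, h2]
  have hpa : a ^ n * a = a ^ (n + 1) := (pow_succ a n).symm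
  have hap : a * a ^ n = a ^ (n + 1) := (pow_succ' a n).symm
  generalize hp : a ^ (n + 1) = p at *
  have hf : p * b = c * p := by
    calc p * b = c * (p * p) * b := by rw [← hc]
      _ = c * (p * p * b) := by noncomm_ring
      _ = c * p := by rw [← hb]
  have hef : e * (p * b) = p * b := by rw [← mul_assoc, hp1]
  have hfe : (p * b) * e = p * b := by rw [hf, mul_assoc, hp2]
  have hff : (p * b) * (p * b) = p * b := by
    calc (p * b) * (p * b) = c * p * (p * b) := by rw [hf]
      _ = c * (p * p * b) := by noncomm_ring
      _ = p * b := by rw [← hb, hf]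
  rcases hprim (p * b) (e - p * b) hff
    (by change (e - p * b) * (e - p * b) = e - p * b
        rw [sub_mul, mul_sub, mul_sub, hee', hef, hfe, hff]; abel)
    (by rw [mul_sub, hfe, hff, sub_self]) (by rw [sub_mul, hef, hff, sub_self])
    (by abel) with h | h
  · left
    refine ⟨n + 1, ?_⟩
    rw [hp, hc, ← mul_assoc, ← hf, h, zero_mul]
  · right
    have hpb : p * b = e := (sub_eq_zero.1 h).symm
    have hcp : c * p = e := by rw [← hf, hpb]
    have ha1 : a * (a ^ n * b * e) = e := by
      rw [← mul_assoc, ← mul_assoc, hap, hpb, hee']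
    have ha2 : (e * c * a ^ n) * a = e := by
      rw [mul_assoc, hpa, mul_assoc, hcp, hee']
    have : e * (a ^ n * b * e) = (e * c * a ^ n) * e := by
      calc e * (a ^ n * b * e) = (e * c * a ^ n * a) * (a ^ n * b * e) := by rw [ha2]
        _ = (e * c * a ^ n) * (a * (a ^ n * b * e)) := by simp only [mul_assoc]
        _ = (e * c * a ^ n) * e := by rw [ha1]
    refine ⟨e * (a ^ n * b * e), ?_, ?_⟩
    · rw [← mul_assoc, h2, ha1]
    · rw [this, mul_assoc, h1, ha2]

theorem snlJ_noninv {e : L} (he : IsPrimitiveIdem e) {a : L} (ha : a ∈ Jset L) :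
    ¬ ∃ w, a * w = e := by
  rintro ⟨w, rfl⟩
  obtain ⟨h0, hee, _⟩ := he
  have hee' : (a * w) * (a * w) = a * w := hee
  have hu : IsUnit (1 - a * w) := snl_isUnit_swap _ _ (ha w)
  have : (1 - a * w) * (a * w) = 0 := by rw [sub_mul, one_mul, hee', sub_self]
  exact h0 (hu.mul_right_eq_zero.1 this)

theorem snl_memJ_right (k : Type u) [CommRing k] [IsArtinianRing k] [Algebra k L]
    [Module.Finite k L] {e : L} (he : IsPrimitiveIdem e) {a : L} (h1 : e * a = a)
    (h : ¬ ∃ w, a * w = e) : a ∈ Jset L := by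
  have hee : e * e = e := he.2.1
  apply snl_nil_mem
  intro y
  apply snl_nil_swap
  rcases snl_dich k he (a * y * e) (by rw [← mul_assoc, ← mul_assoc, h1])
    (by rw [mul_assoc, hee]) with ⟨n, hn⟩ | ⟨w, hw, _⟩
  · refine ⟨n + 1, ?_⟩
    have : ∀ n, (a * y) ^ (n + 1) = (a * y * e) ^ n * (a * y) := by
      intro n
      induction n with
      | zero => simp
      | succ n ih =>
        rw [pow_succ, ih, pow_succ]
        have : a * y * e * (a * y) = a * y * (a * y) := by
          rw [mul_assoc (a * y), ← mul_assoc e, h1]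
        rw [mul_assoc _ (a * y * e), this]
        simp only [mul_assoc]
    rw [this, hn, zero_mul]
  · exact (h ⟨y * e * w, Eq.trans (by simp only [mul_assoc]) hw⟩).elim

theorem snl_memJ_left (k : Type u) [CommRing k] [IsArtinianRing k] [Algebra k L]
    [Module.Finite k L] {e : L} (he : IsPrimitiveIdem e) {a : L} (h1 : a * e = a)
    (h : ¬ ∃ w, w * a = e) : a ∈ Jset L := by
  have hee : e * e = e := he.2.1
  apply snl_nil_mem
  intro y
  rcases snl_dich k he (e * y * a) (by rw [← mul_assoc, ← mul_assoc, hee])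
    (by rw [mul_assoc, h1]) with ⟨n, hn⟩ | ⟨w, _, hw⟩
  · refine ⟨n + 1, ?_⟩
    have : ∀ n, (y * a) ^ (n + 1) = (y * a) * (e * y * a) ^ n := by
      intro n
      induction n with
      | zero => simp
      | succ n ih =>
        rw [pow_succ', ih, pow_succ']
        have : y * a * (e * y * a) = y * a * (y * a) := by
          rw [mul_assoc e, ← mul_assoc _ e, mul_assoc y a e, h1]
        rw [← mul_assoc _ (e * y * a), this]
        simp only [mul_assoc]
    rw [this, hn, mul_zero]
  · exact (h ⟨w * (e * y), Eq.trans (by simp only [mul_assoc]) hw⟩).elim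

theorem snl_offR (k : Type u) [CommRing k] [IsArtinianRing k] [Algebra k L]
    [Module.Finite k L] {e : L} (he : IsBasicIdem e) (x : L) : e * x * (1 - e) ∈ Jset L := by
  have hee : e * e = e := he.1.2.1
  have hqq : (1 - e) * (1 - e) = 1 - e := by simp [mul_sub, sub_mul, hee]
  refine snl_memJ_right k he.1 (by rw [← mul_assoc, ← mul_assoc, hee]) ?_
  rintro ⟨w, hw⟩
  refine he.2 ⟨e * x * (1 - e), (1 - e) * w * e, ?_, ?_, ?_⟩
  · simp only [← mul_assoc, hee]
    simp only [mul_assoc, hqq]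
  · simp only [← mul_assoc, hqq]
    simp only [mul_assoc, hee]
  · calc e * x * (1 - e) * ((1 - e) * w * e) = e * x * ((1 - e) * (1 - e)) * w * e := by
          simp only [mul_assoc]
      _ = e := by rw [hqq, hw, hee]

theorem snl_offL (k : Type u) [CommRing k] [IsArtinianRing k] [Algebra k L]
    [Module.Finite k L] {e : L} (he : IsBasicIdem e) (x : L) : (1 - e) * x * e ∈ Jset L := by
  have hee : e * e = e := he.1.2.1
  have hqq : (1 - e) * (1 - e) = 1 - e := by simp [mul_sub, sub_mul, hee]
  refine snl_memJ_left k he.1 (by rw [mul_assoc, hee]) ?_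
  rintro ⟨w, hw⟩
  refine he.2 ⟨e * w * (1 - e), (1 - e) * x * e, ?_, ?_, ?_⟩
  · simp only [← mul_assoc, hee]
    simp only [mul_assoc, hqq]
  · simp only [← mul_assoc, hqq]
    simp only [mul_assoc, hee]
  · calc e * w * (1 - e) * ((1 - e) * x * e) = e * (w * (((1 - e) * (1 - e)) * x * e)) := by
          simp only [mul_assoc]
      _ = e := by rw [hqq, hw, hee]

/-- Cutting a commutative local ring with square-zero maximal ideal down to length two. -/
theorem snl_cut (B : Type u) [CommRing B] [IsNoetherianRing B] (t0 : B) (ht0 : t0 ≠ 0)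
    (hB : ∀ b : B, IsUnit b ∨ IsUnit (1 - b))
    (hsq : ∀ b c : B, ¬ IsUnit b → ¬ IsUnit c → b * c = 0) (htu : ¬ IsUnit t0) :
    ∃ (R : Type u) (_ : CommRing R) (_ : IsLocalRing R) (_ : IsNoetherianRing R) (q : B →+* R),
      Function.Surjective q ∧ q t0 ≠ 0 ∧ ¬ IsUnit (q t0) ∧
      ∀ r : R, ¬ IsUnit r → ∃ s, r = q t0 * s := by
  obtain ⟨I, hI, hmax⟩ := set_has_maximal_iff_noetherian.2 (inferInstance : IsNoetherian B B)
    {I : Submodule B B | t0 ∉ I} ⟨⊥, by simpa using ht0⟩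
  let I' : Ideal B := I
  have hq : Function.Surjective (Ideal.Quotient.mk I') := Ideal.Quotient.mk_surjective
  have hne : Ideal.Quotient.mk I' t0 ≠ 0 := by
    rw [Ne, Ideal.Quotient.eq_zero_iff_mem]; exact hI
  have : Nontrivial (B ⧸ I') := ⟨⟨_, _, hne⟩⟩
  refine ⟨B ⧸ I', inferInstance, ?_, inferInstance, Ideal.Quotient.mk I', hq, hne, ?_, ?_⟩
  · apply IsLocalRing.of_isUnit_or_isUnit_one_sub_self
    intro a
    obtain ⟨b, rfl⟩ := hq a
    rcases hB b with h | h
    · exact Or.inl (h.map _)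
    · right
      have := h.map (Ideal.Quotient.mk I')
      simpa using this
  · intro h
    apply hne
    have h0 : Ideal.Quotient.mk I' t0 * Ideal.Quotient.mk I' t0 = 0 := by
      rw [← map_mul, hsq t0 t0 htu htu, map_zero]
    exact h.mul_right_eq_zero.1 h0
  · intro r hr
    obtain ⟨b, rfl⟩ := hq r
    by_cases hb : b ∈ I'
    · exact ⟨0, by rw [mul_zero]; exact Ideal.Quotient.eq_zero_iff_mem.2 hb⟩
    have hbu : ¬ IsUnit b := fun h => hr (h.map _)
    have ht : t0 ∈ I' ⊔ Ideal.span {b} := by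
      by_contra hcon
      refine hmax (I' ⊔ Ideal.span {b}) hcon ?_
      refine lt_of_le_of_ne le_sup_left ?_
      intro h
      apply hb
      rw [show I' = I' ⊔ Ideal.span {b} from h]
      exact Ideal.mem_sup_right (Ideal.mem_span_singleton_self b)
    obtain ⟨y, hy, z, hz, hyz⟩ := Submodule.mem_sup.1 ht
    obtain ⟨c, rfl⟩ := Ideal.mem_span_singleton'.1 hz
    have h1 : Ideal.Quotient.mk I' t0 = Ideal.Quotient.mk I' c * Ideal.Quotient.mk I' b := by
      rw [← hyz, map_add, map_mul, Ideal.Quotient.eq_zero_iff_mem.2 hy, zero_add]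
    have hcu : IsUnit c := by
      by_contra hc
      apply hne
      rw [h1, ← map_mul, hsq c b hc hbu, map_zero]
    obtain ⟨w, hw⟩ := hcu.map (Ideal.Quotient.mk I')
    refine ⟨(↑w⁻¹ : B ⧸ I'), ?_⟩
    rw [h1, ← hw, mul_comm, Units.inv_mul_cancel_left]

end RingPart
section Final

variable {L : Type u} [Ring L]

/-- The largest two-sided ideal `I` of `L` with `e I e ⊆ C`. -/
def snlIdeal (e : L) (C : AddSubgroup L) : TwoSidedIdeal L :=
  TwoSidedIdeal.mk' {z | ∀ x y, e * x * z * y * e ∈ C}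
    (by intro x y; simp)
    (by
      intro a b ha hb x y
      have := C.add_mem (ha x y) (hb x y)
      convert this using 1
      noncomm_ring)
    (by
      intro a ha x y
      have := C.neg_mem (ha x y)
      convert this using 1
      noncomm_ring)
    (by
      intro a b hb x y
      have := hb (x * a) y
      convert this using 1
      noncomm_ring)
    (by
      intro a b ha x y
      have := ha x (b * y)
      convert this using 1
      noncomm_ring)

theorem snlIdeal_mem (e : L) (C : AddSubgroup L) (z : L) :
    z ∈ snlIdeal e C ↔ ∀ x y, e * x * z * y * e ∈ C := by
  rw [snlIdeal, TwoSidedIdeal.mem_mk']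
  rfl

/-- The commutative local quotient of length two. -/
theorem snl_exists_R (k : Type u) [CommRing k] [IsArtinianRing k] [Algebra k L]
    [Module.Finite k L] {e : L} (he : IsBasicIdem e)
    (hcomm : ∀ x y : L, (e * x * e) * (e * y * e) - (e * y * e) * (e * x * e) ∈ Jsq L)
    (x : L) (hx : x ∈ Jset L)
    (hxC : e * x * e ∉
        AddSubgroup.closure {y : L | ∃ a ∈ Jset L, ∃ b ∈ Jset L, y = e * (a * b) * e}) :
    ∃ (R : Type u) (_ : CommRing R) (_ : IsLocalRing R) (_ : IsNoetherianRing R) (q : L →+* R),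
      Function.Surjective q ∧ q e = 1 ∧ (∀ a ∈ Jset L, ∀ b ∈ Jset L, q (a * b) = 0) ∧
      q (e * x * e) ≠ 0 ∧ ¬ IsUnit (q (e * x * e)) ∧
      ∀ r : R, ¬ IsUnit r → ∃ s, r = q (e * x * e) * s := by
  set C := AddSubgroup.closure {y : L | ∃ a ∈ Jset L, ∃ b ∈ Jset L, y = e * (a * b) * e} with hC
  have hee : e * e = e := he.1.2.1
  have hqq : (1 - e) * (1 - e) = 1 - e := by simp [mul_sub, sub_mul, hee]
  let I0 := snlIdeal e C
  have hJJ : ∀ a ∈ Jset L, ∀ b ∈ Jset L, a * b ∈ I0 := by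
    intro a ha b hb
    rw [snlIdeal_mem]
    intro u v
    apply AddSubgroup.subset_closure
    exact ⟨u * a, snlJ_left ha u, b * v, snlJ_right hb v, by simp only [mul_assoc]⟩
  have h1e : 1 - e ∈ I0 := by
    rw [snlIdeal_mem]
    intro u v
    apply AddSubgroup.subset_closure
    refine ⟨_, snl_offR k he u, _, snl_offL k he v, ?_⟩
    calc e * u * (1 - e) * v * e = (e * e) * u * ((1 - e) * (1 - e)) * v * (e * e) := by
          rw [hee, hqq]
      _ = _ := by simp only [mul_assoc]
  have hsqI : ∀ z ∈ Jsq L, z ∈ I0 := by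
    intro z hz
    refine AddSubgroup.closure_induction (p := fun z _ => z ∈ I0) ?_ ?_ ?_ ?_ hz
    · rintro _ ⟨a, ha, b, hb, rfl⟩
      exact hJJ a ha b hb
    · exact I0.zero_mem
    · intro a b _ _ ha hb
      exact I0.add_mem ha hb
    · intro a _ ha
      exact I0.neg_mem ha
  have hxI : e * x * e ∉ I0 := by
    intro h
    rw [snlIdeal_mem] at h
    have := h 1 1
    apply hxC
    have e1 : e * 1 * (e * x * e) * 1 * e = e * x * e := by
      simp only [mul_one]
      rw [← mul_assoc, ← mul_assoc, hee, mul_assoc, hee]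
    rwa [e1] at this
  let q0 : L →+* I0.ringCon.Quotient := I0.ringCon.mk'
  have hq0s : Function.Surjective q0 := I0.ringCon.mk'_surjective
  have hq0 : ∀ z, q0 z = 0 ↔ z ∈ I0 := by
    intro z
    rw [TwoSidedIdeal.mem_iff, ← RingCon.eq]
    rfl
  have hq0e : q0 e = 1 := by
    have := (hq0 _).2 h1e
    rw [map_sub, map_one, sub_eq_zero] at this
    exact this.symm
  have hq0ee : ∀ z, q0 (e * z * e) = q0 z := by
    intro z
    rw [map_mul, map_mul, hq0e, one_mul, mul_one]
  have hmc : ∀ a b : I0.ringCon.Quotient, a * b = b * a := by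
    intro a b
    obtain ⟨a, rfl⟩ := hq0s a
    obtain ⟨b, rfl⟩ := hq0s b
    have := (hq0 _).2 (hsqI _ (hcomm a b))
    rw [map_sub, map_mul q0 (e*a*e), map_mul q0 (e*b*e), hq0ee, hq0ee, sub_eq_zero] at this
    exact this
  letI : CommRing I0.ringCon.Quotient :=
    { (inferInstance : Ring I0.ringCon.Quotient) with mul_comm := hmc }
  have : IsNoetherianRing L := IsNoetherianRing.of_finite k L
  have : IsNoetherianRing I0.ringCon.Quotient := isNoetherianRing_of_surjective _ _ q0 hq0s
  have hunit : ∀ a, ¬ IsUnit (q0 a) → e * a * e ∈ Jset L := by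
    intro a ha
    apply snl_memJ_right k he.1
    · rw [← mul_assoc, ← mul_assoc, hee]
    · rintro ⟨w, hw⟩
      apply ha
      have := congrArg q0 hw
      rw [map_mul, hq0ee, hq0e] at this
      exact IsUnit.of_mul_eq_one _ this
  have hxn : ¬ IsUnit (q0 (e * x * e)) := by
    intro h
    obtain ⟨u, hu⟩ := h
    have h0 : q0 (e * x * e) * q0 (e * x * e) = 0 := by
      rw [← map_mul, hq0]
      have := snlJ_right (snlJ_left hx e) e
      exact hJJ _ this _ this
    apply hxI
    rw [← hq0]
    rw [← hu] at h0 ⊢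
    exact u.isUnit.mul_right_eq_zero.1 h0
  obtain ⟨R, i1, i2, i3, q, hq, h1, h2, h3⟩ := snl_cut I0.ringCon.Quotient (q0 (e * x * e))
    (fun h => hxI ((hq0 _).1 h)) (by
      intro b
      obtain ⟨a, rfl⟩ := hq0s b
      by_cases ha : IsUnit (q0 a)
      · exact Or.inl ha
      · right
        have := (hunit a ha 1).map q0
        rwa [one_mul, map_sub, map_one, hq0ee] at this) (by
      intro b c hb hc
      obtain ⟨b, rfl⟩ := hq0s b
      obtain ⟨c, rfl⟩ := hq0s c
      rw [← hq0ee b, ← hq0ee c, ← map_mul, hq0]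
      exact hJJ _ (hunit b hb) _ (hunit c hc)) hxn
  refine ⟨R, i1, i2, i3, q.comp q0, hq.comp hq0s, ?_, ?_, h1, h2, h3⟩
  · rw [RingHom.comp_apply, hq0e, map_one]
  · intro a ha b hb
    rw [RingHom.comp_apply, (hq0 _).2 (hJJ a ha b hb), map_zero]

theorem snl_mk_zero (e : L) (z : eSub L e) :
    (Submodule.Quotient.mk z : SeMod L e) = 0 ↔ (z : L) ∈ Jset L := by
  rw [Submodule.Quotient.mk_eq_zero]
  constructor
  · intro h
    refine Submodule.span_induction (p := fun (w : eSub L e) _ => (w : L) ∈ Jset L)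
      ?_ ?_ ?_ ?_ h
    · intro w hw
      exact hw
    · exact snlJ_zero
    · intro a b _ _ ha hb
      exact snlJ_add ha hb
    · intro c a _ ha
      exact snlJ_right ha c.unop
  · intro h
    exact Submodule.subset_span h

/-- The trace of right multiplication by `a` on the regular module. -/
theorem snlTr_regular {A : Type u} [Ring A] {R : Type u} [CommRing R] [IsLocalRing R] [Module A R]
    [SMulCommClass A R R] (a : A) (t : R) (h : ∀ r : R, a • r = t * r) :
    snlTr R (LinearMap.toSpanSingleton A A a) = t := by
  have e1 : snlPre R (LinearMap.toSpanSingleton A A a) = t • LinearMap.id := by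
    refine LinearMap.ext fun f => LinearMap.ext fun b => ?_
    simp only [snlPre, LinearMap.coe_mk, AddHom.coe_mk, LinearMap.comp_apply,
      LinearMap.toSpanSingleton_apply, LinearMap.smul_apply, LinearMap.id_apply, smul_eq_mul]
    have e2 : f a = t * f 1 := by rw [← h, ← map_smul, smul_eq_mul, mul_one]
    have e3 : f b = b • f 1 := by rw [← map_smul, smul_eq_mul, mul_one]
    rw [← smul_eq_mul, map_smul, e2, e3, ← smul_eq_mul t, smul_comm, smul_eq_mul]
  let E : (A →ₗ[A] R) ≃ₗ[R] R := LinearMap.ringLmapEquivSelf A R R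
  have : Module.Free R (A →ₗ[A] R) := Module.Free.of_equiv E.symm
  rw [snlTr, e1, map_smul, LinearMap.trace_id, E.finrank_eq, Module.finrank_self]
  simp

theorem snl_part1 (k : Type u) [CommRing k] [IsArtinianRing k] [Algebra k L]
    [Module.Finite k L] (e : L) (he : IsBasicIdem e)
    (hcomm : ∀ x y : L, (e * x * e) * (e * y * e) - (e * y * e) * (e * x * e) ∈ Jsq L)
    (hfin : FinInjDim L (SeMod L e)) (x : L) (hx : x ∈ Jset L) : e * x * e ∈
        AddSubgroup.closure {y : L | ∃ a ∈ Jset L, ∃ b ∈ Jset L, y = e * (a * b) * e} := by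
  by_contra hxC
  have hee : e * e = e := he.1.2.1
  obtain ⟨R, _, _, _, q, hq, hqe, hqJ, ht0, htu, ht⟩ := snl_exists_R k he hcomm x hx hxC
  have hxeJ : e * x * e ∈ Jset L := snlJ_right (snlJ_left hx e) e
  generalize hxe : e * x * e = x' at *
  have hx1 : e * x' = x' := by rw [← hxe, ← mul_assoc, ← mul_assoc, hee]
  have hx2 : x' * e = x' := by rw [← hxe, mul_assoc, hee]
  have htt : q x' * q x' = 0 := by rw [← map_mul]; exact hqJ _ hxeJ _ hxeJ
  obtain ⟨n, hn⟩ : IsNilpotent x' := by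
    rcases snl_dich k he.1 x' hx1 hx2 with h | ⟨w, hw, _⟩
    · exact h
    · exact (snlJ_noninv he.1 hxeJ ⟨w, hw⟩).elim
  let qo : Lᵐᵒᵖ →+* R := q.fromOpposite (fun a b => mul_comm _ _)
  letI : Module Lᵐᵒᵖ R := Module.compHom R qo
  have hsm : ∀ (a : Lᵐᵒᵖ) (r : R), a • r = q a.unop * r := fun a r => rfl
  haveI : SMulCommClass Lᵐᵒᵖ R R := ⟨fun a b c => by
    rw [hsm, hsm, smul_eq_mul, smul_eq_mul]; ring⟩
  have : Module.Finite k Lᵐᵒᵖ := Module.Finite.equiv (MulOpposite.opLinearEquiv k)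
  have : IsNoetherianRing Lᵐᵒᵖ := IsNoetherianRing.of_finite k Lᵐᵒᵖ
  obtain ⟨I, f, g, hI, hg, hfg, hf, d, hd⟩ := hfin
  -- the map α
  let α0 : eSub L e →ₗ[Lᵐᵒᵖ] R :=
    { toFun := fun z => q x' * q z.1
      map_add' := by
        intro a b
        rw [Submodule.coe_add, map_add, mul_add]
      map_smul' := by
        intro a b
        rw [Submodule.coe_smul, MulOpposite.smul_eq_mul_unop, map_mul, RingHom.id_apply, hsm]
        ring }
  have hα0 : ∀ z, α0 z = q x' * q z.1 := fun _ => rfl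
  have hαzJ : ∀ z : eSub L e, α0 z = 0 ↔ z.1 ∈ Jset L := by
    intro z
    rw [hα0]
    constructor
    · intro h
      apply snl_memJ_right k he.1 z.2
      rintro ⟨w, hw⟩
      apply ht0
      have := congrArg q hw
      rw [map_mul, hqe] at this
      rw [← mul_one (q x'), ← this, ← mul_assoc, h, zero_mul]
    · intro h
      rw [← map_mul]
      exact hqJ _ hxeJ _ h
  obtain ⟨α, hα⟩ := snl_factor_surj (Submodule.mkQ _ : eSub L e →ₗ[Lᵐᵒᵖ] SeMod L e)
    (Submodule.mkQ_surjective _) α0 (by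
      intro z hz
      rw [hαzJ, ← snl_mk_zero]
      exact hz)
  have hαi : Function.Injective α := by
    rw [injective_iff_map_eq_zero]
    intro s hs
    obtain ⟨z, rfl⟩ := Submodule.mkQ_surjective _ s
    rw [hα, hαzJ, ← snl_mk_zero] at hs
    exact hs
  let T : R →ₗ[Lᵐᵒᵖ] R :=
    { toFun := fun r => q x' * r
      map_add' := fun a b => mul_add _ _ _
      map_smul' := by
        intro a b
        rw [RingHom.id_apply, hsm, hsm]; ring }
  have hαr : ∀ r : R, ∃ s, α s = q x' * r := by
    intro r
    obtain ⟨y, rfl⟩ := hq r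
    refine ⟨Submodule.mkQ _ (⟨e * y, by change e * (e * y) = e * y; rw [← mul_assoc, hee]⟩ : eSub L e), ?_⟩
    rw [hα, hα0, map_mul, hqe, one_mul]
  obtain ⟨β, hβ⟩ := snl_factor_inj α hαi T hαr
  have hab : ∀ r, α (β r) = q x' * r := hβ
  have hβs : Function.Surjective β := by
    intro s
    obtain ⟨z, rfl⟩ := Submodule.mkQ_surjective _ s
    refine ⟨q z.1, hαi ?_⟩
    rw [hab, hα, hα0]
  have hαβ : ∀ p, β p = 0 ↔ ∃ s, α s = p := by
    intro p
    constructor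
    · intro h
      have h0 : q x' * p = 0 := by rw [← hab, h, map_zero]
      obtain ⟨s, rfl⟩ := ht p (by
        intro hu
        exact ht0 (hu.mul_left_eq_zero.1 h0))
      exact hαr s
    · rintro ⟨s, rfl⟩
      obtain ⟨z, rfl⟩ := Submodule.mkQ_surjective _ s
      apply hαi
      rw [hab, hα, hα0, ← mul_assoc, htt, zero_mul, map_zero]
  have key := snl_nil_trace (A := Lᵐᵒᵖ) (I := fun i => (I i : Type u)) f hI
    (by
      intro i y
      rw [← LinearMap.mem_ker, hf i]
      rfl) g hg
    (by
      intro y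
      rw [← LinearMap.mem_ker, hfg]
      rfl) (q x') ht htu htt α β hαi hβs hαβ hab d hd Lᵐᵒᵖ
    (LinearMap.toSpanSingleton Lᵐᵒᵖ Lᵐᵒᵖ (MulOpposite.op x')) n (by
      have : ∀ m (b : Lᵐᵒᵖ), ((LinearMap.toSpanSingleton Lᵐᵒᵖ Lᵐᵒᵖ (MulOpposite.op x')) ^ m) b
          = b * (MulOpposite.op x') ^ m := by
        intro m
        induction m with
        | zero => intro b; simp
        | succ m ih =>
          intro b
          rw [pow_succ, Module.End.mul_apply, ih, pow_succ', ← mul_assoc]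
          rfl
      apply LinearMap.ext
      intro b
      rw [this, ← MulOpposite.op_pow, hn]
      simp)
  rw [snlTr_regular (MulOpposite.op x') (q x') (fun r => hsm _ _)] at key
  exact ht0 key

theorem snl_part2 (k : Type u) [CommRing k] [IsArtinianRing k] [Algebra k L]
    [Module.Finite k L] (e : L) (he : IsBasicIdem e)
    (h : ∀ x ∈ Jset L, e * x * e ∈
        AddSubgroup.closure {y : L | ∃ a ∈ Jset L, ∃ b ∈ Jset L, y = e * (a * b) * e}) :
    Ext1SelfVanishes L (SeMod L e) := by
  intro E _ _ i p hi hp hex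
  have hee : e * e = e := he.1.2.1
  have hex' : ∀ y, p y = 0 ↔ ∃ s, i s = y := by
    intro y
    rw [← LinearMap.mem_ker, hex]
    rfl
  have hSJ : ∀ (s : SeMod L e) (a : L), a ∈ Jset L → MulOpposite.op a • s = 0 := by
    intro s a ha
    obtain ⟨z, rfl⟩ := Submodule.mkQ_surjective _ s
    rw [← map_smul]
    exact (snl_mk_zero e _).2 (snlJ_left ha z.1)
  have hSe : ∀ (s : SeMod L e), MulOpposite.op (1 - e) • s = 0 := by
    intro s
    obtain ⟨z, rfl⟩ := Submodule.mkQ_surjective _ s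
    rw [← map_smul]
    refine (snl_mk_zero e _).2 ?_
    have := snl_offR k he z.1
    rw [show e * z.1 = z.1 from z.2] at this
    exact this
  have hEJJ : ∀ (y : E) (a b : L), a ∈ Jset L → b ∈ Jset L → MulOpposite.op (a * b) • y = 0 := by
    intro y a b ha hb
    rw [MulOpposite.op_mul, mul_smul]
    obtain ⟨s, hs⟩ := (hex' (MulOpposite.op a • y)).1 (by rw [map_smul, hSJ _ _ ha])
    rw [← hs, ← map_smul, hSJ _ _ hb, map_zero]
  let e0 : eSub L e := ⟨e, hee⟩
  obtain ⟨g, hg⟩ := hp (Submodule.mkQ _ e0)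
  let σ0 : eSub L e →ₗ[Lᵐᵒᵖ] E :=
    { toFun := fun z => MulOpposite.op z.1 • g
      map_add' := by
        intro a b
        rw [Submodule.coe_add, MulOpposite.op_add, add_smul]
      map_smul' := by
        intro a b
        rw [Submodule.coe_smul, MulOpposite.smul_eq_mul_unop, MulOpposite.op_mul, mul_smul]
        rfl }
  have hσ0 : ∀ z, σ0 z = MulOpposite.op z.1 • g := fun _ => rfl
  have hpσ : ∀ z, p (σ0 z) = Submodule.mkQ _ z := by
    intro z
    rw [hσ0, map_smul, hg, ← map_smul]
    congr 1
    apply Subtype.ext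
    exact z.2
  have hC : ∀ c ∈ AddSubgroup.closure {y : L | ∃ a ∈ Jset L, ∃ b ∈ Jset L, y = e * (a * b) * e},
      MulOpposite.op c • g = 0 := by
    intro c hc
    refine AddSubgroup.closure_induction (p := fun c _ => MulOpposite.op c • g = 0) ?_ ?_ ?_ ?_ hc
    · rintro _ ⟨a, ha, b, hb, rfl⟩
      have := hEJJ g (e * a) (b * e) (snlJ_left ha e) (snlJ_right hb e)
      simpa only [mul_assoc] using this
    · simp
    · intro a b _ _ ha hb
      rw [MulOpposite.op_add, add_smul, ha, hb, add_zero]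
    · intro a _ ha
      rw [MulOpposite.op_neg, neg_smul, ha, neg_zero]
  obtain ⟨σ, hσ⟩ := snl_factor_surj (Submodule.mkQ _ : eSub L e →ₗ[Lᵐᵒᵖ] SeMod L e)
    (Submodule.mkQ_surjective _) σ0 (by
      intro z hz
      have hzJ : z.1 ∈ Jset L := (snl_mk_zero e z).1 hz
      have h1 := hC _ (h z.1 hzJ)
      rw [show e * z.1 = z.1 from z.2] at h1
      obtain ⟨s, hs⟩ := (hex' (σ0 z)).1 (by rw [hpσ, hz])
      have h2 : MulOpposite.op (1 - e) • σ0 z = 0 := by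
        rw [← hs, ← map_smul, hSe, map_zero]
      rw [hσ0, ← mul_smul, ← MulOpposite.op_mul] at h2
      rw [hσ0]
      have : z.1 = z.1 * e + z.1 * (1 - e) := by noncomm_ring
      rw [this, MulOpposite.op_add, add_smul, h1, h2, add_zero])
  have hpσ' : ∀ s, p (σ s) = s := by
    intro s
    obtain ⟨z, rfl⟩ := Submodule.mkQ_surjective _ s
    rw [hσ, hpσ]
  obtain ⟨r, hr⟩ := snl_factor_inj i hi (LinearMap.id - σ ∘ₗ p) (by
    intro y
    apply (hex' _).1
    simp [hpσ'])
  refine ⟨r, fun s => hi ?_⟩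
  have : p (i s) = 0 := (hex' _).2 ⟨s, rfl⟩
  rw [hr]
  simp [this]

end Final

/-- Theorem 2.1 (injective case): let Λ be an artin algebra with radical J and e a basic
primitive idempotent such that the corner algebra (e+J²)(Λ/J²)(e+J²) is commutative
(i.e. all commutators exeye - eyexe lie in J²).  If S_e = eΛ/eJ has finite injective
dimension, then eJe ⊆ eJ²e; in particular Ext¹_Λ(S_e, S_e) = 0. -/
theorem strong_no_loop_inj (k : Type u) [CommRing k] [IsArtinianRing k]
    (Λ : Type u) [Ring Λ] [Algebra k Λ] [Module.Finite k Λ]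
    (e : Λ) (hbasic : IsBasicIdem e)
    (hcomm : ∀ x y : Λ,
      (e * x * e) * (e * y * e) - (e * y * e) * (e * x * e) ∈ Jsq Λ)
    (hfin : FinInjDim Λ (SeMod Λ e)) :
    (∀ x ∈ Jset Λ, e * x * e ∈
        AddSubgroup.closure {y : Λ | ∃ a ∈ Jset Λ, ∃ b ∈ Jset Λ, y = e * (a * b) * e}) ∧
      Ext1SelfVanishes Λ (SeMod Λ e) := by
  have h1 := snl_part1 k e hbasic hcomm hfin
  exact ⟨h1, snl_part2 k e hbasic h1⟩
end
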